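/- Let μ be a symmetric Borel probability measure on ℝ with ∫_ℝ λ²·(log|λ|)² dμ(λ) < ∞ (the integrand taken to be 0 at λ = 0), and suppose that for some X ∈ (0,∞) and ε > 0 one has μ([X−ε, X+ε]) > 0 and moreover limsup_{δ→0⁺} μ([X−δ, X+δ])/(2δ) = ∞. Let F be a continuous centered stationary Gaussian process with spectral measure μ. Then for every c > 0 there exists T₀ > 0 such that for all T ≥ T₀, P( (X−2ε)/π ≤ N_F(T)/T ≤ (X+2ε)/π ) ≥ exp(−c·T). -/

import Mathlib

open MeasureTheory ProbabilityTheory Set ENNReal NNReal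

/-- The covariance kernel of a spectral measure: `k(t) = ∫ cos (λ t) dμ(λ)`. -/
noncomputable def covKernel (μ : Measure ℝ) (t : ℝ) : ℝ := ∫ l, Real.cos (l * t) ∂μ

/-- `F` is a continuous centered stationary Gaussian process on `(Ω, P)` with spectral
measure `μ`: sample paths are continuous and every finite linear combination
`∑ cᵢ F_{tᵢ}` is a centered real Gaussian with variance `∑ᵢⱼ cᵢ cⱼ k(tᵢ - tⱼ)`. -/
def IsSGP {Ω : Type*} [MeasurableSpace Ω] (P : Measure Ω) (μ : Measure ℝ)
    (F : ℝ → Ω → ℝ) : Prop :=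
  (∀ ω, Continuous fun t => F t ω) ∧
  ∀ (n : ℕ) (t : Fin n → ℝ) (c : Fin n → ℝ),
    P.map (fun ω => ∑ i, c i * F (t i) ω) =
      gaussianReal 0 (∑ i, ∑ j, c i * c j * covKernel μ (t i - t j)).toNNReal

/-- The zero count `N_F(T)` as an extended natural number. -/
noncomputable def zeroCount {Ω : Type*} (F : ℝ → Ω → ℝ) (T : ℝ) (ω : Ω) : ℕ∞ :=
  {t ∈ Set.Icc (0:ℝ) T | F t ω = 0}.encard

/-- The topological support of a Borel measure on ℝ. -/
def msupport (μ : Measure ℝ) : Set ℝ := {x : ℝ | ∀ U ∈ nhds x, 0 < μ U}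

section

open scoped Matrix

/-- A measure on `ι → ℝ` all of whose linear images are centered Gaussians, with variances given by
the quadratic form of `S`. -/
def IsCenteredGaussian {ι : Type*} [Fintype ι] (ρ : Measure (ι → ℝ)) (S : Matrix ι ι ℝ) : Prop :=
  ∀ a : ι → ℝ, ρ.map (fun x => ∑ i, a i * x i) = gaussianReal 0 (a ⬝ᵥ S *ᵥ a).toNNReal

namespace IsCenteredGaussian

variable {ι : Type*} [Fintype ι] {S : Matrix ι ι ℝ}

lemma eq_of_isCenteredGaussian {ρ ρ' : Measure (ι → ℝ)} [IsFiniteMeasure ρ] [IsFiniteMeasure ρ']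
    (h : IsCenteredGaussian ρ S) (h' : IsCenteredGaussian ρ' S) : ρ = ρ' := by
  classical
  refine Measure.ext_of_charFunDual (funext fun L => ?_)
  have hL : ∀ x : ι → ℝ, L x = ∑ i, L (Pi.single i 1) * x i := by
    intro x
    conv_lhs => rw [pi_eq_sum_univ' x]
    simp [map_sum, mul_comm]
  have key : ρ.map L = ρ'.map L := by
    have h1 : (L : (ι → ℝ) → ℝ) = fun x => ∑ i, L (Pi.single i 1) * x i := funext hL
    rw [h1, h, h']
  rw [charFunDual_eq_charFun_map_one, charFunDual_eq_charFun_map_one, key]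

lemma exists_of_posSemidef [DecidableEq ι] (hS : S.PosSemidef) :
    ∃ ρ : Measure (ι → ℝ), IsProbabilityMeasure ρ ∧ IsCenteredGaussian ρ S := by
  refine ⟨(multivariateGaussian 0 S).map (fun x i => x i), ?_, fun a => ?_⟩
  · exact Measure.isProbabilityMeasure_map (by fun_prop)
  · rw [Measure.map_map (by fun_prop) (by fun_prop)]
    refine Measure.ext_of_charFun (funext fun t => ?_)
    have h1 : ((fun x : ι → ℝ => ∑ i, a i * x i) ∘ fun (x : EuclideanSpace ℝ ι) i => x i)
        = fun x : EuclideanSpace ℝ ι => inner ℝ (WithLp.toLp 2 a) x := by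
      ext x; simp [PiLp.inner_apply, mul_comm]
    have h2 : charFun ((multivariateGaussian 0 S).map
        (fun x : EuclideanSpace ℝ ι => inner ℝ (WithLp.toLp 2 a) x)) t
        = charFun (multivariateGaussian 0 S) (t • WithLp.toLp 2 a) := by
      rw [charFun_apply, charFun_apply, integral_map (by fun_prop) (by fun_prop)]
      simp [inner_smul_right, real_inner_comm]
    have h3 : 0 ≤ a ⬝ᵥ S *ᵥ a := by simpa using hS.dotProduct_mulVec_nonneg a
    rw [h1, h2, charFun_multivariateGaussian hS, charFun_gaussianReal]
    congr 1
    simp [Real.coe_toNNReal _ h3, Matrix.mulVec_smul]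
    ring

lemma exists_eq_map_prod [DecidableEq ι] {ρ : Measure (ι → ℝ)} [IsFiniteMeasure ρ]
    (h : IsCenteredGaussian ρ S) (hS : S.IsHermitian) (u : ι → ℝ)
    (hu : ∀ a : ι → ℝ, (a ⬝ᵥ u) ^ 2 ≤ a ⬝ᵥ S *ᵥ a) :
    ∃ ν : Measure (ι → ℝ), IsProbabilityMeasure ν ∧
      ρ = ((gaussianReal 0 1).prod ν).map (fun p i => p.1 * u i + p.2 i) := by
  have hq : ∀ a : ι → ℝ, a ⬝ᵥ (S - Matrix.vecMulVec u u) *ᵥ a = a ⬝ᵥ S *ᵥ a - (a ⬝ᵥ u) ^ 2 := by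
    intro a
    rw [Matrix.sub_mulVec, dotProduct_sub, Matrix.vecMulVec_mulVec]
    simp [dotProduct_comm u a, sq]
  have hpsd : (S - Matrix.vecMulVec u u).PosSemidef := by
    refine Matrix.PosSemidef.of_dotProduct_mulVec_nonneg (hS.sub ?_) fun a => ?_
    · ext i j; simp [Matrix.vecMulVec_apply, mul_comm]
    · have := hu a
      simp only [star_trivial, hq]; linarith
  obtain ⟨ν, hν, hG⟩ := exists_of_posSemidef hpsd
  refine ⟨ν, hν, ?_⟩
  have hm : Measurable (fun (p : ℝ × (ι → ℝ)) i => p.1 * u i + p.2 i) := by fun_prop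
  have := Measure.isProbabilityMeasure_map (μ := (gaussianReal 0 1).prod ν) hm.aemeasurable
  refine eq_of_isCenteredGaussian h (fun a => ?_)
  rw [Measure.map_map (by fun_prop) hm]
  have hind : IndepFun (fun p : ℝ × (ι → ℝ) => (a ⬝ᵥ u) * p.1)
      (fun p => ∑ i, a i * p.2 i) ((gaussianReal 0 1).prod ν) :=
    (indepFun_prod₀ (μ := gaussianReal 0 1) (ν := ν) (X := fun x : ℝ => (a ⬝ᵥ u) * x)
      (Y := fun x : ι → ℝ => ∑ i, a i * x i) (by fun_prop)
      (by fun_prop : Measurable fun x : ι → ℝ => ∑ i, a i * x i).aemeasurable)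
  have e1 : ((gaussianReal 0 1).prod ν).map (fun p : ℝ × (ι → ℝ) => (a ⬝ᵥ u) * p.1)
      = gaussianReal 0 ((a ⬝ᵥ u) ^ 2).toNNReal := by
    have : (fun p : ℝ × (ι → ℝ) => (a ⬝ᵥ u) * p.1) = (fun x => (a ⬝ᵥ u) * x) ∘ Prod.fst := rfl
    rw [this, ← Measure.map_map (by fun_prop) measurable_fst, Measure.map_fst_prod]
    simp only [measure_univ, one_smul]
    rw [gaussianReal_map_const_mul]
    congr 1
    · simp
    · ext; simp [Real.coe_toNNReal _ (sq_nonneg _)]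
  have e2 : ((gaussianReal 0 1).prod ν).map (fun p : ℝ × (ι → ℝ) => ∑ i, a i * p.2 i)
      = gaussianReal 0 (a ⬝ᵥ (S - Matrix.vecMulVec u u) *ᵥ a).toNNReal := by
    have : (fun p : ℝ × (ι → ℝ) => ∑ i, a i * p.2 i)
      = (fun x : ι → ℝ => ∑ i, a i * x i) ∘ Prod.snd := rfl
    rw [this, ← Measure.map_map (by fun_prop) measurable_snd, Measure.map_snd_prod]
    simp only [measure_univ, one_smul]
    exact hG a
  have := gaussianReal_add_gaussianReal_of_indepFun hind e1 e2
  have e3 : (fun x : ι → ℝ => ∑ i, a i * x i) ∘ (fun (p : ℝ × (ι → ℝ)) i => p.1 * u i + p.2 i)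
      = (fun p : ℝ × (ι → ℝ) => (a ⬝ᵥ u) * p.1) + (fun p => ∑ i, a i * p.2 i) := by
    ext p
    simp only [Function.comp, Pi.add_apply, dotProduct, Finset.sum_mul, ← Finset.sum_add_distrib]
    exact Finset.sum_congr rfl fun i _ => by ring
  rw [e3, this, ← Real.toNNReal_add (sq_nonneg _) (by rw [hq]; linarith [hu a]), hq]
  simp

end IsCenteredGaussian

lemma gaussianReal_Ioi_zero_le : gaussianReal 0 1 (Ioi 0) ≤ 1 / 2 := by
  have h1 : gaussianReal 0 1 (Iio 0) = gaussianReal 0 1 (Ioi 0) := by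
    conv_lhs => rw [← neg_zero, ← gaussianReal_map_neg (μ := 0) (v := 1)]
    rw [Measure.map_apply (by fun_prop) measurableSet_Iio]
    simp
  have h2 : gaussianReal 0 1 (Iio 0 ∪ Ioi 0) ≤ 1 := prob_le_one
  rw [measure_union (by rw [Set.disjoint_left]; intro x hx hx'; exact lt_asymm (mem_Iio.1 hx) (mem_Ioi.1 hx'))
    measurableSet_Ioi, h1, ← two_mul] at h2
  rw [ENNReal.le_div_iff_mul_le (by simp) (by simp), mul_comm]
  exact h2

lemma exp_mul_gaussianReal_shift_le {s : ℝ} (hs : 0 ≤ s) {B : Set ℝ} (hB : MeasurableSet B) :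
    ENNReal.ofReal (Real.exp (-s ^ 2 / 2)) * gaussianReal 0 1 {x | x + s ∈ B} ≤
      gaussianReal 0 1 B + ENNReal.ofReal (Real.exp (-s ^ 2 / 2)) * (1 / 2) := by
  set C : Set ℝ := {x | x + s ∈ B} with hC
  have hCm : MeasurableSet C := (measurable_add_const s) hB
  have h1 : gaussianReal 0 1 B = gaussianReal (-s) 1 C := by
    have := gaussianReal_map_add_const (μ := -s) (v := 1) s
    rw [neg_add_cancel] at this
    rw [← this, Measure.map_apply (measurable_add_const s) hB]
    rfl
  have h2 : ENNReal.ofReal (Real.exp (-s ^ 2 / 2)) * gaussianReal 0 1 (C ∩ Iic 0)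
      ≤ gaussianReal (-s) 1 (C ∩ Iic 0) := by
    rw [gaussianReal_apply _ one_ne_zero, gaussianReal_apply _ one_ne_zero,
      ← lintegral_const_mul _ (measurable_gaussianPDF _ _)]
    refine setLIntegral_mono (measurable_gaussianPDF _ _) fun x hx => ?_
    rw [gaussianPDF, gaussianPDF, ← ENNReal.ofReal_mul (Real.exp_pos _).le]
    refine ENNReal.ofReal_le_ofReal ?_
    rw [gaussianPDFReal, gaussianPDFReal, mul_left_comm, ← Real.exp_add]
    refine mul_le_mul_of_nonneg_left (Real.exp_le_exp.2 ?_) (by positivity)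
    have : x ≤ 0 := hx.2
    simp only [NNReal.coe_one]
    nlinarith [mul_nonneg hs (neg_nonneg.2 this)]
  have h3 : gaussianReal 0 1 C ≤ gaussianReal 0 1 (C ∩ Iic 0) + 1 / 2 := by
    refine le_trans (measure_mono ?_) ((measure_union_le (C ∩ Iic 0) (Ioi 0)).trans
      (add_le_add le_rfl gaussianReal_Ioi_zero_le))
    intro x hx
    rcases le_or_gt x 0 with h | h
    · exact Or.inl ⟨hx, h⟩
    · exact Or.inr h
  calc _ ≤ ENNReal.ofReal (Real.exp (-s ^ 2 / 2)) * (gaussianReal 0 1 (C ∩ Iic 0) + 1 / 2) := by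
        gcongr
    _ ≤ _ := by
        rw [mul_add, h1]
        exact add_le_add (h2.trans (measure_mono inter_subset_left)) le_rfl

namespace IsCenteredGaussian

variable {ι : Type*} [Fintype ι] {S : Matrix ι ι ℝ}

/-- A one-sided form of the Cameron–Martin inequality. -/
lemma exp_mul_shift_le [DecidableEq ι] {ρ : Measure (ι → ℝ)} [IsFiniteMeasure ρ]
    (h : IsCenteredGaussian ρ S) (hS : S.IsHermitian) (v : ι → ℝ) {s : ℝ} (hs : 0 < s)
    (hv : ∀ a : ι → ℝ, (a ⬝ᵥ v) ^ 2 ≤ s ^ 2 * (a ⬝ᵥ S *ᵥ a)) {B : Set (ι → ℝ)}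
    (hB : MeasurableSet B) :
    ENNReal.ofReal (Real.exp (-s ^ 2 / 2)) * ρ {x | (fun i => x i + v i) ∈ B} ≤
      ρ B + ENNReal.ofReal (Real.exp (-s ^ 2 / 2)) * (1 / 2) := by
  obtain ⟨ν, hν, hρ⟩ := h.exists_eq_map_prod hS (fun i => s⁻¹ * v i) fun a => by
    have h1 : (a ⬝ᵥ fun i => s⁻¹ * v i) = s⁻¹ * (a ⬝ᵥ v) := by
      simp only [dotProduct, Finset.mul_sum]
      exact Finset.sum_congr rfl fun i _ => by ring
    rw [h1, mul_pow, inv_pow, inv_mul_le_iff₀ (by positivity)]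
    exact hv a
  have hm : Measurable (fun (p : ℝ × (ι → ℝ)) i => p.1 * (s⁻¹ * v i) + p.2 i) := by fun_prop
  have hB' : MeasurableSet {x : ι → ℝ | (fun i => x i + v i) ∈ B} :=
    (by fun_prop : Measurable fun (x : ι → ℝ) i => x i + v i) hB
  rw [hρ, Measure.map_apply hm hB, Measure.map_apply hm hB',
    Measure.prod_apply_symm (hm hB), Measure.prod_apply_symm (hm hB')]
  have hsec : ∀ y : ι → ℝ, ENNReal.ofReal (Real.exp (-s ^ 2 / 2)) *
      gaussianReal 0 1 ((fun x => (x, y)) ⁻¹' ((fun (p : ℝ × (ι → ℝ)) i =>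
        p.1 * (s⁻¹ * v i) + p.2 i) ⁻¹' {x : ι → ℝ | (fun i => x i + v i) ∈ B})) ≤
      gaussianReal 0 1 ((fun x => (x, y)) ⁻¹' ((fun (p : ℝ × (ι → ℝ)) i =>
        p.1 * (s⁻¹ * v i) + p.2 i) ⁻¹' B)) + ENNReal.ofReal (Real.exp (-s ^ 2 / 2)) * (1 / 2) := by
    intro y
    convert exp_mul_gaussianReal_shift_le hs.le
      (B := {x | (fun i => x * (s⁻¹ * v i) + y i) ∈ B})
      ((by fun_prop : Measurable fun (x : ℝ) i => x * (s⁻¹ * v i) + y i) hB) using 4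
    swap
    · rfl
    ext x
    simp only [mem_preimage, mem_ofPred_eq]
    have : (fun i => x * (s⁻¹ * v i) + y i + v i) = fun i => (x + s) * (s⁻¹ * v i) + y i := by
      ext i; field_simp; ring
    rw [this]
  refine (lintegral_const_mul _ (measurable_measure_prodMk_right (hm hB'))).symm.le.trans ?_
  refine (lintegral_mono hsec).trans ?_
  rw [lintegral_add_right _ measurable_const]
  simp

/-- If `u ≥ 1/2` coordinatewise, the maximum coordinate has density at most `4`. -/
lemma measure_max_mem_Ioc_le [DecidableEq ι] {ρ : Measure (ι → ℝ)} [IsFiniteMeasure ρ]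
    (h : IsCenteredGaussian ρ S) (hS : S.IsHermitian) (u : ι → ℝ)
    (hu : ∀ a : ι → ℝ, (a ⬝ᵥ u) ^ 2 ≤ a ⬝ᵥ S *ᵥ a) (hu' : ∀ i, 1 / 2 ≤ u i) {θ : ℝ}
    (hθ : 0 ≤ θ) :
    ρ {x | (∀ i, x i ≤ 0) ∧ ∃ i, -θ < x i} ≤ ENNReal.ofReal (2 * θ) := by
  obtain ⟨ν, hν, hρ⟩ := h.exists_eq_map_prod hS u hu
  have hm : Measurable (fun (p : ℝ × (ι → ℝ)) i => p.1 * u i + p.2 i) := by fun_prop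
  have hB : MeasurableSet {x : ι → ℝ | (∀ i, x i ≤ 0) ∧ ∃ i, -θ < x i} := by
    have : {x : ι → ℝ | (∀ i, x i ≤ 0) ∧ ∃ i, -θ < x i} =
        (⋂ i, {x | x i ≤ 0}) ∩ ⋃ i, {x | -θ < x i} := by ext; simp
    rw [this]
    exact (MeasurableSet.iInter fun i => measurableSet_le (measurable_pi_apply i)
      measurable_const).inter (MeasurableSet.iUnion fun i =>
        measurableSet_lt measurable_const (measurable_pi_apply i))
  rw [hρ, Measure.map_apply hm hB, Measure.prod_apply_symm (hm hB)]
  refine (lintegral_mono (g := fun _ => ENNReal.ofReal (2 * θ)) fun y => ?_).trans (by simp)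
  set A : Set ℝ := (fun x => (x, y)) ⁻¹' ((fun (p : ℝ × (ι → ℝ)) i =>
        p.1 * u i + p.2 i) ⁻¹' {x : ι → ℝ | (∀ i, x i ≤ 0) ∧ ∃ i, -θ < x i}) with hA
  have h1 : gaussianReal 0 1 A ≤ volume A := by
    rw [gaussianReal_apply _ one_ne_zero]
    refine (lintegral_mono (g := fun _ => 1) fun x => ?_).trans (by simp)
    rw [gaussianPDF, ← ENNReal.ofReal_one]
    refine ENNReal.ofReal_le_ofReal ?_
    rw [gaussianPDFReal]
    refine mul_le_one₀ (inv_le_one_of_one_le₀ ?_) (Real.exp_pos _).le ?_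
    · rw [Real.one_le_sqrt]; simp only [NNReal.coe_one]; linarith [Real.pi_gt_three]
    · rw [Real.exp_le_one_iff]; simp only [NNReal.coe_one]; nlinarith [sq_nonneg (x - 0)]
  refine (h1.trans (Real.volume_le_diam A)).trans (Metric.ediam_le ?_)
  have key : ∀ x ∈ A, ∀ x' ∈ A, x' - x ≤ 2 * θ := by
    intro x hx x' hx'
    by_contra hlt
    push Not at hlt
    obtain ⟨i, hi⟩ := hx.2
    have h2 := hx'.1 i
    simp only at hi h2
    nlinarith [hu' i]
  intro x hx x' hx'
  rw [edist_dist]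
  refine ENNReal.ofReal_le_ofReal ?_
  rw [Real.dist_eq, abs_le]
  constructor <;> linarith [key x hx x' hx', key x' hx' x hx]

end IsCenteredGaussian

section Kernel

variable (μ : Measure ℝ) [IsProbabilityMeasure μ]

/-- The covariance matrix of a stationary process at the times `t i`. -/
noncomputable def covMatrix {ι : Type*} (μ : Measure ℝ) (t : ι → ℝ) : Matrix ι ι ℝ :=
  Matrix.of fun i j => covKernel μ (t i - t j)

omit [IsProbabilityMeasure μ] in
lemma covKernel_neg (t : ℝ) : covKernel μ (-t) = covKernel μ t := by
  simp [covKernel]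

lemma covKernel_zero : covKernel μ 0 = 1 := by simp [covKernel]

lemma integrable_cos_mul (t : ℝ) : Integrable (fun l : ℝ => Real.cos (l * t)) μ :=
  Integrable.of_bound (by fun_prop) 1 (ae_of_all _ fun l => Real.abs_cos_le_one _)

lemma covKernel_le_one (t : ℝ) : covKernel μ t ≤ 1 := by
  refine (integral_mono (integrable_cos_mul μ t) (integrable_const 1)
    fun l => Real.cos_le_one _).trans (by simp)

lemma one_sub_le_covKernel (h : Integrable (fun l : ℝ => l ^ 2) μ) (t : ℝ) :
    1 - (∫ l, l ^ 2 ∂μ) * t ^ 2 / 2 ≤ covKernel μ t := by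
  have : 1 - (∫ l, l ^ 2 ∂μ) * t ^ 2 / 2 = ∫ l, (1 - l ^ 2 * (t ^ 2 / 2)) ∂μ := by
    rw [integral_sub (integrable_const 1) (h.mul_const _), integral_mul_const]
    simp; ring
  rw [this]
  refine integral_mono ((integrable_const 1).sub (h.mul_const _)) (integrable_cos_mul μ t)
    fun l => ?_
  have := Real.one_sub_sq_div_two_le_cos (x := l * t)
  simp only
  linarith [mul_pow l t 2]

omit [IsProbabilityMeasure μ] in
lemma covMatrix_isHermitian {ι : Type*} (t : ι → ℝ) : (covMatrix μ t).IsHermitian := by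
  ext i j
  simp only [covMatrix, Matrix.conjTranspose_apply, Matrix.of_apply, star_trivial]
  rw [← covKernel_neg, neg_sub]

variable {ι : Type*} [Fintype ι]

omit [IsProbabilityMeasure μ] in
lemma dotProduct_covMatrix_mulVec (t a : ι → ℝ) :
    a ⬝ᵥ covMatrix μ t *ᵥ a = ∑ i, ∑ j, a i * a j * covKernel μ (t i - t j) := by
  simp only [dotProduct, Matrix.mulVec, covMatrix, Matrix.of_apply, Finset.mul_sum]
  exact Finset.sum_congr rfl fun i _ => Finset.sum_congr rfl fun j _ => by ring

lemma dotProduct_covMatrix_mulVec_eq_integral (t a : ι → ℝ) (t₀ : ℝ) :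
    a ⬝ᵥ covMatrix μ t *ᵥ a = ∫ l, ((∑ i, a i * Real.cos (l * (t i - t₀))) ^ 2 +
      (∑ i, a i * Real.sin (l * (t i - t₀))) ^ 2) ∂μ := by
  have h1 : ∀ l : ℝ, (∑ i, a i * Real.cos (l * (t i - t₀))) ^ 2 +
      (∑ i, a i * Real.sin (l * (t i - t₀))) ^ 2 =
      ∑ i, ∑ j, a i * a j * Real.cos (l * (t i - t j)) := by
    intro l
    rw [sq, sq, Finset.sum_mul_sum, Finset.sum_mul_sum, ← Finset.sum_add_distrib]
    refine Finset.sum_congr rfl fun i _ => ?_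
    rw [← Finset.sum_add_distrib]
    refine Finset.sum_congr rfl fun j _ => ?_
    have : l * (t i - t j) = l * (t i - t₀) - l * (t j - t₀) := by ring
    rw [this, Real.cos_sub]; ring
  simp_rw [h1, dotProduct_covMatrix_mulVec]
  rw [integral_finsetSum _ fun i _ => integrable_finsetSum _ fun j _ =>
    (integrable_cos_mul μ _).const_mul _]
  refine Finset.sum_congr rfl fun i _ => ?_
  rw [integral_finsetSum _ fun j _ => (integrable_cos_mul μ _).const_mul _]
  refine Finset.sum_congr rfl fun j _ => ?_
  rw [integral_const_mul, covKernel]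

lemma sq_setIntegral_le {f : ℝ → ℝ} (hf : Integrable f μ) (hf2 : Integrable (fun x => f x ^ 2) μ)
    (I : Set ℝ) : (∫ x in I, f x ∂μ) ^ 2 ≤ μ.real I * ∫ x, f x ^ 2 ∂μ := by
  have h0 : 0 ≤ ∫ x in I, (f x * μ.real I - ∫ y in I, f y ∂μ) ^ 2 ∂μ :=
    integral_nonneg fun x => sq_nonneg _
  set J := ∫ y in I, f y ∂μ with hJ
  set m := μ.real I with hm
  have h1 : ∫ x in I, (f x * m - J) ^ 2 ∂μ
      = m ^ 2 * (∫ x in I, f x ^ 2 ∂μ) - 2 * m * J * J + J ^ 2 * m := by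
    have e : ∀ x, (f x * m - J) ^ 2 = (m ^ 2 * f x ^ 2 - 2 * m * J * f x) + J ^ 2 := by
      intro x; ring
    simp_rw [e]
    have i1 : Integrable (fun x => m ^ 2 * f x ^ 2 - 2 * m * J * f x) (μ.restrict I) :=
      (hf2.integrableOn.const_mul _).sub (hf.integrableOn.const_mul _)
    rw [integral_add i1 (integrable_const _), integral_sub (hf2.integrableOn.const_mul _)
      (hf.integrableOn.const_mul _), integral_const_mul, integral_const_mul, ← hJ]
    simp [hm, mul_comm]
  have h2 : ∫ x in I, f x ^ 2 ∂μ ≤ ∫ x, f x ^ 2 ∂μ :=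
    setIntegral_le_integral hf2 (ae_of_all _ fun x => sq_nonneg _)
  have hm0 : 0 ≤ m := measureReal_nonneg
  rcases hm0.eq_or_lt with h | h
  · have : μ.restrict I = 0 := by
      rw [Measure.restrict_eq_zero]
      exact (measureReal_eq_zero_iff).1 (hm.symm.trans h.symm)
    have hJ0 : J = 0 := by rw [hJ, this]; simp
    rw [hJ0, ← h]; simp
  · have h3 : m * J ^ 2 ≤ m * (m * ∫ x in I, f x ^ 2 ∂μ) := by nlinarith
    exact (le_of_mul_le_mul_left h3 h).trans (by gcongr)

lemma sq_dotProduct_setIntegral_cos_le (t : ι → ℝ) (t₀ : ℝ) (I : Set ℝ) (a : ι → ℝ) :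
    (a ⬝ᵥ fun i => ∫ l in I, Real.cos (l * (t i - t₀)) ∂μ) ^ 2 ≤
      μ.real I * (a ⬝ᵥ covMatrix μ t *ᵥ a) := by
  have hb : ∀ (g : ℝ → ℝ), Continuous g → (∃ C, ∀ x, |g x| ≤ C) → Integrable g μ :=
    fun g hg ⟨C, hC⟩ => Integrable.of_bound hg.aestronglyMeasurable C (ae_of_all _ hC)
  have hc : ∀ x : ℝ, |∑ i, a i * Real.cos (x * (t i - t₀))| ≤ ∑ i, |a i| := fun x =>
    (Finset.abs_sum_le_sum_abs _ _).trans (Finset.sum_le_sum fun i _ => by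
      rw [abs_mul]; exact mul_le_of_le_one_right (abs_nonneg _) (Real.abs_cos_le_one _))
  have hs : ∀ x : ℝ, |∑ i, a i * Real.sin (x * (t i - t₀))| ≤ ∑ i, |a i| := fun x =>
    (Finset.abs_sum_le_sum_abs _ _).trans (Finset.sum_le_sum fun i _ => by
      rw [abs_mul]; exact mul_le_of_le_one_right (abs_nonneg _) (Real.abs_sin_le_one _))
  have i1 := hb (fun x => ∑ i, a i * Real.cos (x * (t i - t₀))) (by fun_prop) ⟨_, hc⟩
  have i2 := hb (fun x => (∑ i, a i * Real.cos (x * (t i - t₀))) ^ 2) (by fun_prop)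
    ⟨_, fun x => by rw [abs_pow]; exact pow_le_pow_left₀ (abs_nonneg _) (hc x) 2⟩
  have i3 := hb (fun x => (∑ i, a i * Real.sin (x * (t i - t₀))) ^ 2) (by fun_prop)
    ⟨_, fun x => by rw [abs_pow]; exact pow_le_pow_left₀ (abs_nonneg _) (hs x) 2⟩
  have e : (a ⬝ᵥ fun i => ∫ l in I, Real.cos (l * (t i - t₀)) ∂μ)
      = ∫ l in I, ∑ i, a i * Real.cos (l * (t i - t₀)) ∂μ := by
    rw [integral_finsetSum _ fun i _ => ((integrable_cos_mul μ _).integrableOn.const_mul _)]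
    simp only [dotProduct, integral_const_mul]
  rw [e, dotProduct_covMatrix_mulVec_eq_integral μ t a t₀]
  refine (sq_setIntegral_le μ i1 i2 I).trans ?_
  refine mul_le_mul_of_nonneg_left (integral_mono i2 (i2.add i3) fun x => ?_) measureReal_nonneg
  simp only
  exact le_add_of_nonneg_right (sq_nonneg _)

end Kernel

namespace IsSGP

variable {Ω : Type*} [MeasurableSpace Ω] {P : Measure Ω} {μ : Measure ℝ} {F : ℝ → Ω → ℝ}

lemma aemeasurable (hF : IsSGP P μ F) (t : ℝ) : AEMeasurable (F t) P := by
  have := hF.2 1 (fun _ => t) (fun _ => 1)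
  simp only [Finset.univ_unique, Finset.sum_const, Finset.card_singleton, one_smul, one_mul] at this
  apply AEMeasurable.of_map_ne_zero
  rw [this]
  exact NeZero.ne _

lemma aemeasurable_pi (hF : IsSGP P μ F) {ι : Type*} [Fintype ι] (t : ι → ℝ) :
    AEMeasurable (fun ω i => F (t i) ω) P :=
  aemeasurable_pi_lambda _ fun i => hF.aemeasurable (t i)

lemma isCenteredGaussian (hF : IsSGP P μ F) {n : ℕ} (t : Fin n → ℝ) :
    IsCenteredGaussian (P.map fun ω i => F (t i) ω) (covMatrix μ t) := by
  intro a
  rw [AEMeasurable.map_map_of_aemeasurable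
    (by fun_prop : Measurable fun x : Fin n → ℝ => ∑ i, a i * x i).aemeasurable (hF.aemeasurable_pi t),
    dotProduct_covMatrix_mulVec]
  exact hF.2 n t a

lemma neg (hF : IsSGP P μ F) : IsSGP P μ fun t ω => -F t ω := by
  refine ⟨fun ω => (hF.1 ω).neg, fun n t c => ?_⟩
  have := hF.2 n t fun i => -c i
  simpa using this

lemma map_eq_gaussianReal [IsProbabilityMeasure μ] (hF : IsSGP P μ F) (t : ℝ) :
    P.map (F t) = gaussianReal 0 1 := by
  have := hF.2 1 (fun _ => t) (fun _ => 1)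
  simpa [covKernel_zero] using this

lemma measure_eq_zero [IsProbabilityMeasure μ] (hF : IsSGP P μ F) (t : ℝ) :
    P {ω | F t ω = 0} = 0 := by
  have h : P.map (F t) {0} = 0 := by
    rw [hF.map_eq_gaussianReal]
    have := nullSingletonClass_gaussianReal (μ := 0) (v := 1) one_ne_zero
    exact measure_singleton 0
  rwa [Measure.map_apply_of_aemeasurable (hF.aemeasurable t) (measurableSet_singleton 0)] at h

lemma measure_le_abs_le [IsProbabilityMeasure μ] (hF : IsSGP P μ F) (t : ℝ) {a : ℝ} (ha : 0 < a) :
    P {ω | a ≤ |F t ω|} ≤ ENNReal.ofReal (1 / a ^ 2) := by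
  have hm : MeasurableSet {x : ℝ | a ≤ |x|} := measurableSet_le measurable_const (by fun_prop)
  have h1 : P {ω | a ≤ |F t ω|} = gaussianReal 0 1 {x : ℝ | a ≤ |x|} := by
    rw [← hF.map_eq_gaussianReal t, Measure.map_apply_of_aemeasurable (hF.aemeasurable t) hm]
    rfl
  rw [h1]
  have := meas_ge_le_variance_div_sq (μ := gaussianReal 0 1) (X := id)
    (memLp_id_gaussianReal' 2 (by simp)) ha
  simpa [variance_id_gaussianReal] using this

end IsSGP

lemma gaussianReal_le_exp_mul_volume {v : ℝ≥0} (hv : 1 / 2 ≤ v) (hv' : v ≤ 1) {K : ℝ} (hK : 0 ≤ K)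
    {B : Set ℝ} (hB : ∀ x ∈ B, K ≤ |x|) :
    gaussianReal 0 v B ≤ ENNReal.ofReal (Real.exp (-K ^ 2 / 2)) * volume B := by
  have hv0 : v ≠ 0 := by rintro rfl; simp at hv
  have h1 : (1 / 2 : ℝ) ≤ v := by exact_mod_cast hv
  have h2 : (v : ℝ) ≤ 1 := by exact_mod_cast hv'
  rw [gaussianReal_apply _ hv0]
  refine (setLIntegral_mono (g := fun _ => ENNReal.ofReal (Real.exp (-K ^ 2 / 2)))
    measurable_const fun x hx => ?_).trans (by rw [setLIntegral_const])
  refine ENNReal.ofReal_le_ofReal ?_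
  rw [gaussianPDFReal]
  refine (mul_le_of_le_one_left (Real.exp_pos _).le (inv_le_one_of_one_le₀ ?_)).trans
    (Real.exp_le_exp.2 ?_)
  · rw [Real.one_le_sqrt]; nlinarith [Real.pi_gt_three]
  · have h3 : K ^ 2 ≤ x ^ 2 := by rw [← sq_abs x]; exact pow_le_pow_left₀ hK (hB x hx) 2
    rw [sub_zero, neg_div, neg_div, neg_le_neg_iff, div_le_div_iff₀ (by norm_num) (by linarith)]
    nlinarith [sq_nonneg K]

lemma gaussianReal_Icc_le {v : ℝ≥0} (hv : 1 / 2 ≤ v) (hv' : v ≤ 1) (m : ℝ) {r : ℝ} :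
    gaussianReal 0 v (Icc (-m - r) (-m + r)) ≤ ENNReal.ofReal (2 * r) := by
  refine (gaussianReal_le_exp_mul_volume hv hv' le_rfl fun x _ => abs_nonneg x).trans ?_
  rw [Real.volume_Icc, ← ENNReal.ofReal_mul (Real.exp_pos _).le]
  refine ENNReal.ofReal_le_ofReal ?_
  simp only [ne_eq, OfNat.ofNat_ne_zero, not_false_eq_true, zero_pow, neg_zero, zero_div,
    Real.exp_zero]
  linarith

lemma gaussianReal_Icc_le_of_le_abs {v : ℝ≥0} (hv : 1 / 2 ≤ v) (hv' : v ≤ 1) {m K r : ℝ}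
    (hK : 0 < K) (hm : 2 * K ≤ |m|) (hr : 0 ≤ r) :
    gaussianReal 0 v (Icc (-m - r) (-m + r)) ≤
      ENNReal.ofReal (Real.exp (-K ^ 2 / 2) * (2 * r) + 1 / K ^ 2 * r ^ 2) := by
  have hexp := (Real.exp_pos (-K ^ 2 / 2)).le
  rcases le_or_gt r K with h | h
  · refine (gaussianReal_le_exp_mul_volume (K := K) hv hv' hK.le fun x hx => ?_).trans ?_
    · have h1 : |x + m| ≤ r := abs_le.2 ⟨by linarith [hx.1], by linarith [hx.2]⟩
      have h2 : |m| ≤ |x + m| + |x| := by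
        have := abs_sub (x + m) x; rwa [add_sub_cancel_left] at this
      linarith
    · rw [Real.volume_Icc, ← ENNReal.ofReal_mul hexp]
      refine ENNReal.ofReal_le_ofReal ?_
      have : -m + r - (-m - r) = 2 * r := by ring
      rw [this]
      exact le_add_of_nonneg_right (by positivity)
  · refine prob_le_one.trans ?_
    rw [← ENNReal.ofReal_one]
    refine ENNReal.ofReal_le_ofReal ?_
    have : 1 ≤ 1 / K ^ 2 * r ^ 2 := by
      rw [one_div_mul_eq_div, one_le_div (by positivity)]
      exact pow_le_pow_left₀ hK.le h.le 2
    have h3 : 0 ≤ Real.exp (-K ^ 2 / 2) * (2 * r) := by positivity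
    linarith

lemma lintegral_sq_gaussianReal {v : ℝ} (hv : 0 ≤ v) {α β : ℝ} (hα : 0 ≤ α) (hβ : 0 ≤ β) :
    ∫⁻ y, ENNReal.ofReal (α * y ^ 2 + β) ∂gaussianReal 0 v.toNNReal =
      ENNReal.ofReal (α * v + β) := by
  have hi : Integrable (fun y : ℝ => y ^ 2) (gaussianReal 0 v.toNNReal) :=
    (memLp_id_gaussianReal' 2 (by simp)).integrable_sq
  have hi2 : Integrable (fun y : ℝ => α * y ^ 2 + β) (gaussianReal 0 v.toNNReal) :=
    (hi.const_mul _).add (integrable_const _)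
  rw [← ofReal_integral_eq_lintegral_ofReal hi2 (ae_of_all _ fun y => by positivity)]
  rw [integral_add (hi.const_mul _) (integrable_const _), integral_const_mul]
  have := variance_of_integral_eq_zero (μ := gaussianReal 0 v.toNNReal) (X := id)
    aemeasurable_id (by simp)
  rw [variance_id_gaussianReal, Real.coe_toNNReal _ hv] at this
  simp only [id] at this
  rw [← this]; simp

lemma prod_gaussianReal_abs_add_le {v w m τ q b : ℝ} (hw : 0 ≤ w) (hτ : 0 < τ) (hq0 : 0 ≤ q)
    (hb0 : 0 ≤ b) (hq : ∀ r, 0 ≤ r → gaussianReal 0 v.toNNReal (Icc (-m - r) (-m + r)) ≤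
      ENNReal.ofReal (q * (2 * r) + b * r ^ 2)) :
    ((gaussianReal 0 v.toNNReal).prod (gaussianReal 0 w.toNNReal))
      {p | |p.1 + m| ≤ |p.2| + τ} ≤
      ENNReal.ofReal (q * (w / τ + 3 * τ) + b * (2 * w + 2 * τ ^ 2)) := by
  have hm : MeasurableSet {p : ℝ × ℝ | |p.1 + m| ≤ |p.2| + τ} :=
    measurableSet_le (by fun_prop) (by fun_prop)
  rw [Measure.prod_apply_symm hm]
  have hle : ∀ y : ℝ, gaussianReal 0 v.toNNReal
      ((fun x => (x, y)) ⁻¹' {p : ℝ × ℝ | |p.1 + m| ≤ |p.2| + τ}) ≤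
      ENNReal.ofReal ((q / τ + 2 * b) * y ^ 2 + (q * (3 * τ) + b * (2 * τ ^ 2))) := by
    intro y
    have e : (fun x => (x, y)) ⁻¹' {p : ℝ × ℝ | |p.1 + m| ≤ |p.2| + τ} =
        Icc (-m - (|y| + τ)) (-m + (|y| + τ)) := by
      ext x
      simp only [mem_preimage, mem_ofPred_eq, mem_Icc, abs_le]
      constructor <;> rintro ⟨h1, h2⟩ <;> constructor <;> linarith
    rw [e]
    refine (hq _ (by positivity)).trans (ENNReal.ofReal_le_ofReal ?_)
    have h1 : 2 * (|y| + τ) ≤ y ^ 2 / τ + 3 * τ := by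
      have : 0 ≤ (|y| - τ) ^ 2 / τ := by positivity
      have h : (|y| - τ) ^ 2 / τ = y ^ 2 / τ - 2 * |y| + τ := by
        rw [← sq_abs y]; field_simp; ring
      linarith
    have h2 : (|y| + τ) ^ 2 ≤ 2 * y ^ 2 + 2 * τ ^ 2 := by
      rw [← sq_abs y]; nlinarith [sq_nonneg (|y| - τ)]
    calc _ ≤ q * (y ^ 2 / τ + 3 * τ) + b * (2 * y ^ 2 + 2 * τ ^ 2) := by gcongr
      _ = _ := by ring
  refine (lintegral_mono hle).trans ?_
  rw [lintegral_sq_gaussianReal hw (by positivity) (by positivity)]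
  refine ENNReal.ofReal_le_ofReal (le_of_eq ?_)
  ring

namespace IsSGP

variable {Ω : Type*} [MeasurableSpace Ω] {P : Measure Ω} [IsProbabilityMeasure P] {μ : Measure ℝ}
  [IsProbabilityMeasure μ] {F : ℝ → Ω → ℝ}

lemma measure_mean_sub_mem (hF : IsSGP P μ F) (t τ : ℝ) (hk : -1 ≤ covKernel μ τ) {B : Set (ℝ × ℝ)}
    (hB : MeasurableSet B) :
    P {ω | ((F t ω + F (t + τ) ω) / 2, F (t + τ) ω - F t ω) ∈ B} =
      ((gaussianReal 0 ((1 + covKernel μ τ) / 2).toNNReal).prod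
        (gaussianReal 0 (2 * (1 - covKernel μ τ)).toNNReal)) B := by
  have hk1 := covKernel_le_one μ τ
  set k := covKernel μ τ with hk_def
  set γ := (gaussianReal 0 ((1 + k) / 2).toNNReal).prod (gaussianReal 0 (2 * (1 - k)).toNNReal)
  have h1 := hF.isCenteredGaussian ![t, t + τ]
  have hm : Measurable fun (p : ℝ × ℝ) (i : Fin 2) => ![p.1 - p.2 / 2, p.1 + p.2 / 2] i := by
    refine measurable_pi_lambda _ fun i => ?_
    fin_cases i <;> simp <;> fun_prop
  have h2 : IsCenteredGaussian (γ.map fun p i => ![p.1 - p.2 / 2, p.1 + p.2 / 2] i)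
      (covMatrix μ ![t, t + τ]) := by
    intro a
    rw [Measure.map_map (by fun_prop) hm]
    have hind : IndepFun (fun p : ℝ × ℝ => (a 0 + a 1) * p.1)
        (fun p => ((a 1 - a 0) / 2) * p.2) γ :=
      indepFun_prod₀ (X := fun x : ℝ => (a 0 + a 1) * x)
        (Y := fun x : ℝ => ((a 1 - a 0) / 2) * x) (by fun_prop) (by fun_prop)
    have e1 : γ.map (fun p : ℝ × ℝ => (a 0 + a 1) * p.1)
        = gaussianReal 0 ((a 0 + a 1) ^ 2 * ((1 + k) / 2)).toNNReal := by
      have : (fun p : ℝ × ℝ => (a 0 + a 1) * p.1) = (fun x => (a 0 + a 1) * x) ∘ Prod.fst := rfl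
      rw [this, ← Measure.map_map (by fun_prop) measurable_fst, Measure.map_fst_prod]
      simp only [measure_univ, one_smul]
      rw [gaussianReal_map_const_mul]
      congr 1
      · simp
      · rw [Real.toNNReal_mul (sq_nonneg _)]; congr 1
        ext; simp [Real.coe_toNNReal _ (sq_nonneg _)]
    have e2 : γ.map (fun p : ℝ × ℝ => ((a 1 - a 0) / 2) * p.2)
        = gaussianReal 0 (((a 1 - a 0) / 2) ^ 2 * (2 * (1 - k))).toNNReal := by
      have : (fun p : ℝ × ℝ => ((a 1 - a 0) / 2) * p.2)
        = (fun x => ((a 1 - a 0) / 2) * x) ∘ Prod.snd := rfl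
      rw [this, ← Measure.map_map (by fun_prop) measurable_snd, Measure.map_snd_prod]
      simp only [measure_univ, one_smul]
      rw [gaussianReal_map_const_mul]
      congr 1
      · simp
      · rw [Real.toNNReal_mul (sq_nonneg _)]; congr 1
        ext; simp [Real.coe_toNNReal _ (sq_nonneg _)]
    have e3 : (fun x : Fin 2 → ℝ => ∑ i, a i * x i) ∘
        (fun (p : ℝ × ℝ) (i : Fin 2) => ![p.1 - p.2 / 2, p.1 + p.2 / 2] i)
        = (fun p : ℝ × ℝ => (a 0 + a 1) * p.1) + (fun p => ((a 1 - a 0) / 2) * p.2) := by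
      ext p; simp [Fin.sum_univ_two]; ring
    rw [e3, gaussianReal_add_gaussianReal_of_indepFun hind e1 e2, ← Real.toNNReal_add
      (mul_nonneg (sq_nonneg _) (by linarith)) (mul_nonneg (sq_nonneg _) (by linarith)),
      dotProduct_covMatrix_mulVec]
    congr 2
    · simp
    · simp only [Fin.sum_univ_two, Matrix.cons_val_zero, Matrix.cons_val_one, sub_self,
        covKernel_zero, add_sub_cancel_left, ← hk_def]
      rw [show t - (t + τ) = -τ by ring, covKernel_neg, ← hk_def]
      ring
  have := Measure.isProbabilityMeasure_map (μ := P) (hF.aemeasurable_pi ![t, t + τ])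
  have := Measure.isProbabilityMeasure_map (μ := γ) hm.aemeasurable
  have h3 := h1.eq_of_isCenteredGaussian h2
  have hB' : MeasurableSet {x : Fin 2 → ℝ | ((x 0 + x 1) / 2, x 1 - x 0) ∈ B} :=
    (by fun_prop : Measurable fun x : Fin 2 → ℝ => ((x 0 + x 1) / 2, x 1 - x 0)) hB
  have h4 := congrArg (fun ρ => ρ {x : Fin 2 → ℝ | ((x 0 + x 1) / 2, x 1 - x 0) ∈ B}) h3
  rw [Measure.map_apply hm hB', Measure.map_apply_of_aemeasurable (hF.aemeasurable_pi _) hB'] at h4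
  refine (Eq.trans ?_ h4).trans ?_
  · rfl
  · congr 1
    ext p
    simp only [mem_preimage, mem_ofPred_eq, Matrix.cons_val_zero, Matrix.cons_val_one]
    rw [show ((p.1 - p.2 / 2 + (p.1 + p.2 / 2)) / 2, p.1 + p.2 / 2 - (p.1 - p.2 / 2)) = p by
      ext <;> simp]

variable {Λ τ : ℝ}

lemma measure_abs_mean_add_le_of_forall (hF : IsSGP P μ F)
    (hΛ : ∀ s, 1 - Λ * s ^ 2 / 2 ≤ covKernel μ s) (hτ : 0 < τ) (hΛτ : Λ * τ ^ 2 ≤ 1) (t m : ℝ)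
    {q b : ℝ} (hq0 : 0 ≤ q) (hb0 : 0 ≤ b) (hq : ∀ v : ℝ≥0, 1 / 2 ≤ v → v ≤ 1 → ∀ r, 0 ≤ r →
      gaussianReal 0 v (Icc (-m - r) (-m + r)) ≤ ENNReal.ofReal (q * (2 * r) + b * r ^ 2)) :
    P {ω | |(F t ω + F (t + τ) ω) / 2 + m| ≤ |F (t + τ) ω - F t ω| + τ} ≤
      ENNReal.ofReal (q * ((Λ + 3) * τ) + b * ((2 * Λ + 2) * τ ^ 2)) := by
  have hk1 := covKernel_le_one μ τ
  have hk2 := hΛ τ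
  have hB : MeasurableSet {p : ℝ × ℝ | |p.1 + m| ≤ |p.2| + τ} :=
    measurableSet_le (by fun_prop) (by fun_prop)
  have h := hF.measure_mean_sub_mem t τ (by linarith) hB
  simp only [mem_ofPred_eq] at h
  rw [h]
  refine (prod_gaussianReal_abs_add_le (by linarith) hτ hq0 hb0 (hq _ ?_ ?_)).trans
    (ENNReal.ofReal_le_ofReal ?_)
  · rw [← NNReal.coe_le_coe, Real.coe_toNNReal _ (by linarith)]
    push_cast; linarith
  · rw [Real.toNNReal_le_one]; linarith
  · have h1 : 2 * (1 - covKernel μ τ) ≤ Λ * τ ^ 2 := by linarith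
    have h2 : 2 * (1 - covKernel μ τ) / τ ≤ Λ * τ := by
      rw [div_le_iff₀ hτ]; linarith
    have : (2 * Λ + 2) * τ ^ 2 = 2 * (Λ * τ ^ 2) + 2 * τ ^ 2 := by ring
    rw [add_mul, this]
    gcongr

lemma measure_abs_mean_add_le (hF : IsSGP P μ F)
    (hΛ : ∀ s, 1 - Λ * s ^ 2 / 2 ≤ covKernel μ s) (hτ : 0 < τ) (hΛτ : Λ * τ ^ 2 ≤ 1) (t m : ℝ) :
    P {ω | |(F t ω + F (t + τ) ω) / 2 + m| ≤ |F (t + τ) ω - F t ω| + τ} ≤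
      ENNReal.ofReal ((Λ + 3) * τ) := by
  have := hF.measure_abs_mean_add_le_of_forall hΛ hτ hΛτ t m zero_le_one le_rfl
    fun v hv hv' r _ => by simpa using gaussianReal_Icc_le hv hv' m
  simpa using this

lemma measure_abs_mean_add_le_of_le_abs (hF : IsSGP P μ F)
    (hΛ : ∀ s, 1 - Λ * s ^ 2 / 2 ≤ covKernel μ s) (hτ : 0 < τ) (hΛτ : Λ * τ ^ 2 ≤ 1) (t : ℝ)
    {m K : ℝ} (hK : 0 < K) (hm : 2 * K ≤ |m|) :
    P {ω | |(F t ω + F (t + τ) ω) / 2 + m| ≤ |F (t + τ) ω - F t ω| + τ} ≤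
      ENNReal.ofReal (Real.exp (-K ^ 2 / 2) * ((Λ + 3) * τ) +
        1 / K ^ 2 * ((2 * Λ + 2) * τ ^ 2)) :=
  hF.measure_abs_mean_add_le_of_forall hΛ hτ hΛτ t m (Real.exp_pos _).le (by positivity)
    fun _ hv hv' _ hr => gaussianReal_Icc_le_of_le_abs hv hv' hK hm hr

end IsSGP

lemma measure_le_of_forall_eventually_mem {α : Type*} [MeasurableSpace α] {ν : Measure α}
    {B : Set α} {G : ℕ → Set α} {p : ℝ≥0∞} (h : ∀ x ∈ B, ∀ᶠ m in Filter.atTop, x ∈ G m)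
    (hG : ∀ᶠ m in Filter.atTop, ν (G m) ≤ p) : ν B ≤ p := by
  have hsub : B ⊆ ⋃ M : ℕ, ⋂ m ∈ Ici M, G m := fun x hx => by
    obtain ⟨M, hM⟩ := Filter.eventually_atTop.1 (h x hx)
    exact mem_iUnion.2 ⟨M, mem_iInter₂.2 hM⟩
  have hmono : Monotone fun M : ℕ => ⋂ m ∈ Ici M, G m := fun M N hMN =>
    biInter_subset_biInter_left (Ici_subset_Ici.2 hMN)
  refine (measure_mono hsub).trans ?_
  rw [hmono.measure_iUnion]
  refine iSup_le fun M => ?_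
  obtain ⟨N, hN⟩ := Filter.eventually_atTop.1 hG
  exact (measure_mono (biInter_subset_of_mem (mem_Ici.2 (le_max_left M N)))).trans
    (hN _ (le_max_right M N))

lemma exists_grid_dist_lt {a b z η : ℝ} (hz : z ∈ Icc a b) (hη : 0 < η) :
    ∀ᶠ m : ℕ in Filter.atTop, ∃ i : Fin (m + 1), |a + i * ((b - a) / m) - z| < η := by
  filter_upwards [Filter.eventually_gt_atTop 0,
    tendsto_const_div_atTop_nhds_zero_nat (b - a) |>.eventually_lt_const hη] with m hm hlt
  have hm' : (0 : ℝ) < m := by exact_mod_cast hm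
  rcases eq_or_lt_of_le (hz.1.trans hz.2) with hab | hab
  · refine ⟨0, ?_⟩
    have : z = a := le_antisymm (hab ▸ hz.2) hz.1
    simpa [this] using hη
  have hs : 0 < (b - a) / m := div_pos (by linarith) hm'
  have h0 : 0 ≤ (z - a) / ((b - a) / m) := div_nonneg (by linarith [hz.1]) hs.le
  have hle : (z - a) / ((b - a) / m) ≤ m := by
    rw [div_le_iff₀ hs, mul_div_cancel₀ _ hm'.ne']; linarith [hz.2]
  refine ⟨⟨⌊(z - a) / ((b - a) / m)⌋₊, ?_⟩, ?_⟩
  · exact Nat.lt_succ_of_le (Nat.floor_le_of_le hle)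
  · have h1 := (le_div_iff₀ hs).1 (Nat.floor_le h0)
    have h2 := (div_lt_iff₀ hs).1 (Nat.lt_floor_add_one ((z - a) / ((b - a) / m)))
    rw [abs_lt]
    constructor <;> simp only <;> linarith

namespace IsSGP

variable {Ω : Type*} [MeasurableSpace Ω] {P : Measure Ω} [IsProbabilityMeasure P] {μ : Measure ℝ}
  [IsProbabilityMeasure μ] {F : ℝ → Ω → ℝ}

lemma measure_forall_nonpos_exists_eq_zero (hF : IsSGP P μ F) {a b : ℝ}
    (hk : ∀ s, |s| ≤ b - a → 1 / 2 ≤ covKernel μ s) :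
    P {ω | (∀ t ∈ Icc a b, F t ω ≤ 0) ∧ ∃ t ∈ Icc a b, F t ω = 0} = 0 := by
  rcases lt_or_ge b a with hab | hab
  · simp [Icc_eq_empty_of_lt hab]
  refine le_antisymm (le_of_forall_gt fun q hq => ?_) zero_le
  obtain ⟨θ, hθ, hθq⟩ : ∃ θ : ℝ, 0 < θ ∧ ENNReal.ofReal (2 * θ) < q := by
    obtain ⟨r, hr, hrq⟩ := ENNReal.lt_iff_exists_nnreal_btwn.1 hq
    have hr' : 0 < r := by exact_mod_cast hr
    refine ⟨r / 2, by positivity, ?_⟩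
    rwa [mul_div_cancel₀ _ (by norm_num : (2 : ℝ) ≠ 0), ENNReal.ofReal_coe_nnreal]
  refine lt_of_le_of_lt ?_ hθq
  let t (m : ℕ) (i : Fin (m + 1)) : ℝ := a + i * ((b - a) / m)
  have ht : ∀ m i, t m i ∈ Icc a b := fun m i => by
    have h1 : (i : ℝ) ≤ m := by exact_mod_cast Nat.lt_succ_iff.1 i.2
    have h2 : 0 ≤ (b - a) / m := div_nonneg (by linarith) (Nat.cast_nonneg m)
    refine ⟨?_, ?_⟩
    · simp only [t]; nlinarith [(Nat.cast_nonneg (i : ℕ) : (0 : ℝ) ≤ ((i : ℕ) : ℝ))]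
    · have : (i : ℝ) * ((b - a) / m) ≤ b - a := by
        rcases Nat.eq_zero_or_pos m with rfl | hm
        · simp; linarith
        · calc (i : ℝ) * ((b - a) / m) ≤ m * ((b - a) / m) := by gcongr
            _ = b - a := mul_div_cancel₀ _ (by positivity)
      simp only [t]; linarith
  refine measure_le_of_forall_eventually_mem
    (G := fun m => {ω | (∀ i, F (t m i) ω ≤ 0) ∧ ∃ i, -θ < F (t m i) ω}) ?_ ?_
  · rintro ω ⟨h1, z, hz, h0⟩
    have hc := (hF.1 ω).continuousAt (x := z)
    obtain ⟨η, hη, hηF⟩ := Metric.continuousAt_iff.1 hc θ hθ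
    filter_upwards [exists_grid_dist_lt hz hη] with m ⟨i, hi⟩
    refine ⟨fun i => h1 _ (ht m i), i, ?_⟩
    have := hηF (x := t m i) (by rwa [Real.dist_eq])
    rw [h0, Real.dist_eq, sub_zero] at this
    exact (abs_lt.1 this).1
  · refine Filter.Eventually.of_forall fun m => ?_
    have hG := hF.isCenteredGaussian (t m)
    have := Measure.isProbabilityMeasure_map (μ := P) (hF.aemeasurable_pi (t m))
    have hle := hG.measure_max_mem_Ioc_le (u := fun i => covKernel μ (t m i - a)) (θ := θ)
      (covMatrix_isHermitian μ _) (fun c => ?_) (fun i => hk _ ?_) hθ.le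
    · exact (Measure.le_map_apply (hF.aemeasurable_pi (t m)) _).trans hle
    · simpa [covKernel] using sq_dotProduct_setIntegral_cos_le μ (t m) a univ c
    · have := ht m i
      rw [abs_of_nonneg] <;> linarith [this.1, this.2]

lemma ae_exists_pos_of_eq_zero (hF : IsSGP P μ F) {Λ : ℝ}
    (hΛ : ∀ s, 1 - Λ * s ^ 2 / 2 ≤ covKernel μ s) :
    ∀ᵐ ω ∂P, ∀ z, F z ω = 0 → ∀ η > 0, ∃ t, |t - z| < η ∧ 0 < F t ω := by
  obtain ⟨δ, hδ, hδk⟩ : ∃ δ : ℝ, 0 < δ ∧ ∀ s, |s| ≤ δ → 1 / 2 ≤ covKernel μ s := by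
    refine ⟨1 / (1 + |Λ|), by positivity, fun s hs => ?_⟩
    have h1 : s ^ 2 ≤ 1 / (1 + |Λ|) := by
      have h2 : |s| ≤ 1 := hs.trans ((div_le_one (by positivity)).2 (by linarith [abs_nonneg Λ]))
      rw [← sq_abs]; nlinarith [abs_nonneg s]
    have h3 : Λ * s ^ 2 ≤ 1 := by
      calc Λ * s ^ 2 ≤ |Λ| * (1 / (1 + |Λ|)) := by
            gcongr; exact le_abs_self _
        _ ≤ 1 := by rw [mul_one_div, div_le_one (by positivity)]; linarith
    linarith [hΛ s]
  have hae : ∀ᵐ ω ∂P, ∀ a b : ℚ, (b - a : ℝ) ≤ δ →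
      ¬((∀ t ∈ Icc (a : ℝ) b, F t ω ≤ 0) ∧ ∃ t ∈ Icc (a : ℝ) b, F t ω = 0) := by
    rw [ae_all_iff]; intro a
    rw [ae_all_iff]; intro b
    by_cases hab : (b - a : ℝ) ≤ δ
    · have := hF.measure_forall_nonpos_exists_eq_zero (a := a) (b := b)
        fun s hs => hδk s (hs.trans hab)
      rw [ae_iff]
      simpa only [hab, true_imp_iff, not_not] using this
    · exact ae_of_all _ fun ω h => absurd h hab
  filter_upwards [hae] with ω hω z hz η hη
  by_contra! hcon
  have hm : 0 < min (δ / 2) η := lt_min (by positivity) hη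
  obtain ⟨a, ha1, ha2⟩ := exists_rat_btwn (show z - min (δ / 2) η < z by linarith)
  obtain ⟨b, hb1, hb2⟩ := exists_rat_btwn (show z < z + min (δ / 2) η by linarith)
  have hd := min_le_left (δ / 2) η
  have he := min_le_right (δ / 2) η
  refine hω a b (by linarith) ⟨fun t ht => hcon t ?_, z, ⟨ha2.le, hb1.le⟩, hz⟩
  rw [abs_lt]
  constructor <;> linarith [ht.1, ht.2]

lemma ae_crossing (hF : IsSGP P μ F) {Λ : ℝ} (hΛ : ∀ s, 1 - Λ * s ^ 2 / 2 ≤ covKernel μ s) :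
    ∀ᵐ ω ∂P, ∀ z, F z ω = 0 → ∀ η > 0,
      (∃ t, |t - z| < η ∧ 0 < F t ω) ∧ ∃ t, |t - z| < η ∧ F t ω < 0 := by
  filter_upwards [hF.ae_exists_pos_of_eq_zero hΛ, hF.neg.ae_exists_pos_of_eq_zero hΛ]
    with ω h1 h2 z hz η hη
  refine ⟨h1 z hz η hη, ?_⟩
  simpa using h2 z (by simpa using hz) η hη

end IsSGP

lemma exists_nat_mul_dist_lt {σ x η : ℝ} (hσ : 0 < σ) (hx : 0 ≤ x) (hη : 0 < η) :
    ∀ᶠ M : ℕ in Filter.atTop, ∃ i : ℕ, |i * (σ / M) - x| < η := by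
  filter_upwards [Filter.eventually_gt_atTop 0,
    tendsto_const_div_atTop_nhds_zero_nat σ |>.eventually_lt_const hη] with M hM hlt
  have hs : 0 < σ / M := by positivity
  have h1 := (le_div_iff₀ hs).1 (Nat.floor_le (div_nonneg hx hs.le))
  have h2 := (div_lt_iff₀ hs).1 (Nat.lt_floor_add_one (x / (σ / M)))
  refine ⟨⌊x / (σ / M)⌋₊, ?_⟩
  rw [abs_lt]
  constructor <;> linarith

/-- The indices of the steps of the grid `τ ℕ` inside `[a, b]` over which `g` changes from
negative to nonnegative values. -/
def upSteps (g : ℝ → ℝ) (τ a b : ℝ) : Set ℕ :=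
  {i | a ≤ i * τ ∧ ((i + 1 : ℕ) : ℝ) * τ ≤ b ∧ g (i * τ) < 0 ∧ 0 ≤ g ((i + 1 : ℕ) * τ)}

lemma upSteps_nonempty {g : ℝ → ℝ} (hg : Continuous g)
    (hcross : ∀ z, g z = 0 → ∀ η > 0, (∃ t, |t - z| < η ∧ 0 < g t) ∧ ∃ t, |t - z| < η ∧ g t < 0)
    {σ m b z z' : ℝ} (hσ : 0 < σ) (hm : 0 ≤ m) (hmz : m < z) (hzz : z < z') (hzb : z' < b)
    (hz : g z = 0) (hz' : g z' = 0) :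
    ∀ᶠ M : ℕ in Filter.atTop, (upSteps g (σ / M) m b).Nonempty := by
  set η := min (z - m) (min ((z' - z) / 2) (b - z')) with hη
  have hη0 : 0 < η := lt_min (by linarith) (lt_min (by linarith) (by linarith))
  have e1 : η ≤ z - m := min_le_left _ _
  have e2 : η ≤ (z' - z) / 2 := (min_le_right _ _).trans (min_le_left _ _)
  have e3 : η ≤ b - z' := (min_le_right _ _).trans (min_le_right _ _)
  obtain ⟨x, hx, hgx⟩ := (hcross z hz η hη0).2
  obtain ⟨y, hy, hgy⟩ := (hcross z' hz' η hη0).1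
  rw [abs_lt] at hx hy
  have hxm : m < x := by linarith
  have hxy : x < y := by linarith
  have hyb : y < b := by linarith
  have n1 : ∀ᶠ t in nhds x, m < t ∧ t < (x + y) / 2 ∧ g t < 0 :=
    (eventually_gt_nhds hxm).and ((eventually_lt_nhds (by linarith)).and
      (hg.continuousAt.eventually_lt_const hgx))
  have n2 : ∀ᶠ t in nhds y, (x + y) / 2 < t ∧ t < b ∧ 0 < g t :=
    (eventually_gt_nhds (by linarith)).and ((eventually_lt_nhds hyb).and
      (hg.continuousAt.eventually_const_lt hgy))
  obtain ⟨η1, hη1, h1⟩ := Metric.eventually_nhds_iff.1 n1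
  obtain ⟨η2, hη2, h2⟩ := Metric.eventually_nhds_iff.1 n2
  filter_upwards [exists_nat_mul_dist_lt hσ (hm.trans hxm.le) hη1,
    exists_nat_mul_dist_lt hσ (hm.trans (hxm.trans hxy).le) hη2,
    Filter.eventually_gt_atTop 0] with M ⟨i, hi⟩ ⟨k, hk⟩ hM
  have hτ : 0 < σ / M := by positivity
  obtain ⟨i1, i2, i3⟩ := h1 (y := i * (σ / M)) (by rwa [Real.dist_eq])
  obtain ⟨k1, k2, k3⟩ := h2 (y := k * (σ / M)) (by rwa [Real.dist_eq])
  have hik : i < k := by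
    have : (i : ℝ) * (σ / M) < k * (σ / M) := by linarith
    exact_mod_cast (mul_lt_mul_iff_left₀ hτ).1 this
  classical
  have hex : ∃ l, 0 ≤ g ((i + l : ℕ) * (σ / M)) :=
    ⟨k - i, by rw [Nat.add_sub_cancel' hik.le]; exact k3.le⟩
  have hl0 : Nat.find hex ≠ 0 := fun h => by
    have := Nat.find_spec hex
    rw [h, add_zero] at this
    linarith
  obtain ⟨l, hl⟩ := Nat.exists_eq_succ_of_ne_zero hl0
  have hlk : l + 1 ≤ k - i := by
    rw [← Nat.succ_eq_add_one, ← hl]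
    exact Nat.find_min' hex (by rw [Nat.add_sub_cancel' hik.le]; exact k3.le)
  refine ⟨i + l, ?_, ?_, ?_, ?_⟩
  · have : (i : ℝ) * (σ / M) ≤ (i + l : ℕ) * (σ / M) := by gcongr; omega
    linarith
  · have : ((i + l + 1 : ℕ) : ℝ) * (σ / M) ≤ k * (σ / M) := by gcongr; omega
    linarith
  · have := Nat.find_min hex (m := l) (by omega)
    linarith
  · have := Nat.find_spec hex
    rwa [hl, Nat.succ_eq_add_one, ← add_assoc] at this

lemma card_zeros_le_encard_upSteps {g : ℝ → ℝ} (hg : Continuous g)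
    (hcross : ∀ z, g z = 0 → ∀ η > 0, (∃ t, |t - z| < η ∧ 0 < g t) ∧ ∃ t, |t - z| < η ∧ g t < 0)
    {σ a : ℝ} (hσ : 0 < σ) (ha : 0 ≤ a) (p : ℕ) :
    ∀ (Z : Finset ℝ) (b : ℝ), Z.card = p → (∀ z ∈ Z, g z = 0 ∧ a < z ∧ z < b) →
      ∀ᶠ M : ℕ in Filter.atTop, (p : ℕ∞) ≤ 1 + 2 * (upSteps g (σ / M) a b).encard := by
  induction p using Nat.strong_induction_on with
  | _ p ih =>
    intro Z b hp hZ
    rcases Nat.lt_or_ge p 2 with h2 | h2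
    · refine Filter.Eventually.of_forall fun M => le_add_right ?_
      exact_mod_cast Nat.lt_succ_iff.1 h2
    have hne : Z.Nonempty := Finset.card_pos.1 (by omega)
    have hz' := Z.max'_mem hne
    have hc1 := Finset.card_erase_of_mem hz'
    have hne1 : (Z.erase (Z.max' hne)).Nonempty := Finset.card_pos.1 (by omega)
    set z' := Z.max' hne
    have hz1 := (Z.erase z').max'_mem hne1
    have hc2 := Finset.card_erase_of_mem hz1
    have hmax : ∀ w ∈ (Z.erase z').erase ((Z.erase z').max' hne1),
        w < (Z.erase z').max' hne1 := fun w hw =>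
      Finset.lt_max'_of_mem_erase_max' _ hne1 hw
    have hzz : (Z.erase z').max' hne1 < z' := Finset.lt_max'_of_mem_erase_max' _ hne hz1
    set z := (Z.erase z').max' hne1
    have hz : z ∈ Z := Finset.mem_of_mem_erase hz1
    obtain ⟨m, hm1, hm2⟩ : ∃ m, (∀ w ∈ insert a ((Z.erase z').erase z), w < m) ∧ m < z := by
      have hI : (insert a ((Z.erase z').erase z)).Nonempty := Finset.insert_nonempty _ _
      obtain ⟨m, h1, h2⟩ := exists_between (a₁ := (insert a ((Z.erase z').erase z)).max' hI)
        (a₂ := z) ((Finset.max'_lt_iff _ hI).2 fun w hw => by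
          rcases Finset.mem_insert.1 hw with rfl | hw
          · exact (hZ z hz).2.1
          · exact hmax w hw)
      exact ⟨m, (Finset.max'_lt_iff _ hI).1 h1, h2⟩
    have ham : a < m := hm1 a (Finset.mem_insert_self _ _)
    have hih := ih (p - 2) (by omega) ((Z.erase z').erase z) m (by omega) fun w hw =>
      ⟨(hZ w (Finset.mem_of_mem_erase (Finset.mem_of_mem_erase hw))).1,
        (hZ w (Finset.mem_of_mem_erase (Finset.mem_of_mem_erase hw))).2.1,
        hm1 w (Finset.mem_insert_of_mem hw)⟩
    filter_upwards [hih, upSteps_nonempty hg hcross hσ (ha.trans ham.le) hm2 hzz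
      (hZ z' hz').2.2 (hZ z hz).1 (hZ z' hz').1, Filter.eventually_gt_atTop 0] with M hM hMne hM0
    have hτ : 0 < σ / M := by positivity
    have hsub : upSteps g (σ / M) a m ∪ upSteps g (σ / M) m b ⊆ upSteps g (σ / M) a b := by
      rintro i (⟨h1, h2, h3⟩ | ⟨h1, h2, h3⟩)
      · exact ⟨h1, by linarith [(hZ z hz).2.2], h3⟩
      · exact ⟨by linarith, h2, h3⟩
    have hdisj : Disjoint (upSteps g (σ / M) a m) (upSteps g (σ / M) m b) := by
      rw [Set.disjoint_left]
      rintro i ⟨-, h1, -⟩ ⟨h2, -⟩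
      push_cast at h1
      linarith
    have h1 : (1 : ℕ∞) ≤ (upSteps g (σ / M) m b).encard := Set.one_le_encard_iff_nonempty.2 hMne
    have h3 : (upSteps g (σ / M) a m).encard + 1 ≤ (upSteps g (σ / M) a b).encard := by
      refine le_trans ?_ (Set.encard_le_encard hsub)
      rw [Set.encard_union_eq hdisj]
      gcongr
    calc (p : ℕ∞) = ((p - 2 : ℕ) : ℕ∞) + 2 := by
          exact_mod_cast (Nat.sub_add_cancel h2).symm
      _ ≤ 1 + 2 * (upSteps g (σ / M) a m).encard + 2 := by gcongr
      _ = 1 + 2 * ((upSteps g (σ / M) a m).encard + 1) := by ring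
      _ ≤ _ := by gcongr

/-- The sequence `(-1) ^ j * x`, restricted to the `j`-th block of length `M`, changes from negative
to nonnegative values at its `l`-th step. -/
def IsUpStep (x : ℕ → ℝ) (M j l : ℕ) : Prop :=
  (-1) ^ j * x (j * M + l) < 0 ∧ 0 ≤ (-1) ^ j * x (j * M + l + 1)

noncomputable instance (x : ℕ → ℝ) (M j l : ℕ) : Decidable (IsUpStep x M j l) :=
  inferInstanceAs (Decidable (_ ∧ _))

/-- The number of up-steps of `x` in the first `n` blocks of length `M`. -/
noncomputable def upCount (x : ℕ → ℝ) (M n : ℕ) : ℕ :=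
  ∑ j ∈ Finset.range n, ((Finset.range M).filter fun l => IsUpStep x M j l).card

/-- The number of the endpoints of the first `n` blocks of length `M` at which `x` does not have
the sign pattern `1, -1, 1, …`. -/
noncomputable def badCount (x : ℕ → ℝ) (M n : ℕ) : ℕ :=
  ((Finset.range (n + 1)).filter fun j => (-1) ^ j * x (j * M) ≤ 0).card

lemma encard_upSteps_le {f : ℝ → ℝ} {σ : ℝ} (hσ : 0 < σ) {M : ℕ} (hM : 0 < M) (j : ℕ) :
    (upSteps (fun t => (-1) ^ j * f t) (σ / M) (j * σ) ((j + 1 : ℕ) * σ)).encard ≤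
      ((Finset.range M).filter fun l => IsUpStep (fun i => f (i * (σ / M))) M j l).card := by
  have hM' : (0 : ℝ) < M := by exact_mod_cast hM
  have hτ : 0 < σ / M := by positivity
  have hsub : upSteps (fun t => (-1) ^ j * f t) (σ / M) (j * σ) ((j + 1 : ℕ) * σ) ⊆
      (fun l => j * M + l) ''
        ((Finset.range M).filter fun l => IsUpStep (fun i => f (i * (σ / M))) M j l) := by
    rintro i ⟨h1, h2, h3, h4⟩
    have e : ∀ k : ℕ, (k : ℝ) * σ = (k * M : ℕ) * (σ / M) := fun k => by
      push_cast; field_simp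
    rw [e] at h1 h2
    have h1' : j * M ≤ i := by exact_mod_cast (mul_le_mul_iff_left₀ hτ).1 h1
    have h2' : i + 1 ≤ (j + 1) * M := by exact_mod_cast (mul_le_mul_iff_left₀ hτ).1 h2
    rw [add_mul, one_mul] at h2'
    refine ⟨i - j * M, ?_, Nat.add_sub_cancel' h1'⟩
    rw [Finset.mem_coe, Finset.mem_filter, Finset.mem_range, IsUpStep, Nat.add_sub_cancel' h1']
    exact ⟨by omega, h3, h4⟩
  refine (encard_le_encard hsub).trans ((encard_image_le _ _).trans ?_)
  rw [encard_coe_eq_coe_finsetCard]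

lemma card_zeros_le_upCount {f : ℝ → ℝ} (hf : Continuous f)
    (hcross : ∀ z, f z = 0 → ∀ η > 0, (∃ t, |t - z| < η ∧ 0 < f t) ∧ ∃ t, |t - z| < η ∧ f t < 0)
    {σ : ℝ} (hσ : 0 < σ) (hne : ∀ j : ℕ, f (j * σ) ≠ 0) (n : ℕ) (Z : Finset ℝ)
    (hZ : ∀ z ∈ Z, f z = 0 ∧ z ∈ Icc 0 (n * σ)) :
    ∀ᶠ M : ℕ in Filter.atTop, Z.card ≤ n + 2 * upCount (fun i => f (i * (σ / M))) M n := by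
  have hmap : ∀ z ∈ Z, ⌊z / σ⌋₊ ∈ Finset.range n := fun z hz => by
    obtain ⟨h0, h1, h2⟩ := hZ z hz
    have h3 : z < n * σ := lt_of_le_of_ne h2 fun h => hne n (h ▸ h0)
    rw [Finset.mem_range, Nat.floor_lt (by positivity), div_lt_iff₀ hσ]
    exact h3
  have hblock : ∀ j : ℕ, ∀ᶠ M : ℕ in Filter.atTop, (Z.filter fun z => ⌊z / σ⌋₊ = j).card ≤
      1 + 2 * ((Finset.range M).filter fun l => IsUpStep (fun i => f (i * (σ / M))) M j l).card := by
    intro j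
    have hsign : ((-1 : ℝ) ^ j = 1) ∨ ((-1 : ℝ) ^ j = -1) := neg_one_pow_eq_or ℝ j
    have hc : ∀ z, (-1 : ℝ) ^ j * f z = 0 → ∀ η > 0,
        (∃ t, |t - z| < η ∧ 0 < (-1 : ℝ) ^ j * f t) ∧ ∃ t, |t - z| < η ∧ (-1 : ℝ) ^ j * f t < 0 := by
      intro z hz η hη
      rcases hsign with h | h <;> rw [h] at hz ⊢
      · simpa using hcross z (by simpa using hz) η hη
      · simpa using (hcross z (by simpa using hz) η hη).symm
    have hb : ∀ z ∈ Z.filter fun z => ⌊z / σ⌋₊ = j,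
        (-1 : ℝ) ^ j * f z = 0 ∧ j * σ < z ∧ z < (j + 1 : ℕ) * σ := by
      intro z hz
      rw [Finset.mem_filter] at hz
      obtain ⟨h0, h1, h2⟩ := hZ z hz.1
      have h3 := (Nat.floor_eq_iff (by positivity)).1 hz.2
      rw [le_div_iff₀ hσ, div_lt_iff₀ hσ] at h3
      refine ⟨by rw [h0, mul_zero], lt_of_le_of_ne h3.1 fun h => hne j (h ▸ h0), ?_⟩
      push_cast
      exact h3.2
    filter_upwards [card_zeros_le_encard_upSteps (continuous_const.mul hf) hc hσ
      (by positivity : (0 : ℝ) ≤ j * σ) _ _ _ rfl hb, Filter.eventually_gt_atTop 0] with M hM hM0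
    have := hM.trans (add_le_add_right (mul_le_mul_right (encard_upSteps_le hσ hM0 j) 2) 1)
    exact_mod_cast this
  filter_upwards [(Finset.eventually_all (Finset.range n)).2 fun j _ => hblock j] with M hM
  rw [Finset.card_eq_sum_card_fiberwise hmap, upCount, Finset.mul_sum]
  refine (Finset.sum_le_sum hM).trans ?_
  rw [Finset.sum_add_distrib]
  simp

lemma le_card_zeros_add_badCount {f : ℝ → ℝ} (hf : Continuous f) {σ : ℝ} (hσ : 0 < σ) (n : ℕ)
    (Z : Finset ℝ) (hZ : ∀ z ∈ Icc 0 (n * σ), f z = 0 → z ∈ Z) {M : ℕ} (hM : 0 < M) :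
    n ≤ Z.card + 2 * badCount (fun i => f (i * (σ / M))) M n := by
  have hM' : (0 : ℝ) < M := by exact_mod_cast hM
  set b : ℕ → Prop := fun j => (-1) ^ j * f (j * σ) ≤ 0 with hb
  have hbc : badCount (fun i => f (i * (σ / M))) M n = ((Finset.range (n + 1)).filter b).card := by
    rw [badCount]
    congr 1
    refine Finset.filter_congr fun j _ => ?_
    rw [hb]
    have : ((j * M : ℕ) : ℝ) * (σ / M) = j * σ := by push_cast; field_simp
    rw [this]
  have h1 : Finset.range n ⊆ Z.image (fun z => ⌊z / σ⌋₊) ∪ ((Finset.range (n + 1)).filter b ∪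
      ((Finset.range (n + 1)).filter b).image fun j => j - 1) := by
    intro j hj
    rw [Finset.mem_range] at hj
    simp only [Finset.mem_union, Finset.mem_image, Finset.mem_filter, Finset.mem_range]
    by_cases h : b j
    · exact Or.inr (Or.inl ⟨by omega, h⟩)
    by_cases h' : b (j + 1)
    · exact Or.inr (Or.inr ⟨j + 1, ⟨by omega, h'⟩, rfl⟩)
    left
    simp only [hb, not_le, pow_succ, mul_neg, mul_one, neg_mul, Left.neg_pos_iff] at h h'
    have hlt : (j : ℝ) * σ ≤ (j + 1 : ℕ) * σ := by push_cast; nlinarith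
    obtain ⟨z, hz, hz0⟩ := intermediate_value_Ioo' hlt
      (f := fun t => (-1) ^ j * f t) (by fun_prop) (mem_Ioo.2 ⟨h', h⟩)
    have hz0' : f z = 0 := by
      simpa using hz0
    have hzn : z ≤ n * σ := hz.2.le.trans (by gcongr; omega)
    have hj0 : (0 : ℝ) ≤ j * σ := by positivity
    have hz1 : 0 ≤ z := hj0.trans hz.1.le
    refine ⟨z, hZ z ⟨hz1, hzn⟩ hz0', ?_⟩
    rw [Nat.floor_eq_iff (by positivity), le_div_iff₀ hσ, div_lt_iff₀ hσ]
    exact ⟨hz.1.le, by simpa using hz.2⟩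
  have h2 := (Finset.card_le_card h1).trans ((Finset.card_union_le _ _).trans
    (add_le_add Finset.card_image_le ((Finset.card_union_le _ _).trans
      (add_le_add le_rfl Finset.card_image_le))))
  rw [Finset.card_range] at h2
  rw [hbc]
  omega

lemma card_filter_abs_sub_lt_le (s : Finset ℕ) (x : ℝ) {r : ℝ} (hr : 0 ≤ r) :
    ((s.filter fun l : ℕ => |(l : ℝ) - x| < r).card : ℝ) ≤ 2 * r + 1 := by
  rcases (s.filter fun l : ℕ => |(l : ℝ) - x| < r).eq_empty_or_nonempty with h | h
  · rw [h]; simp; positivity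
  set S := s.filter fun l : ℕ => |(l : ℝ) - x| < r
  have h1 := (Finset.mem_filter.1 (S.min'_mem h)).2
  have h2 := (Finset.mem_filter.1 (S.max'_mem h)).2
  have h3 : S ⊆ Finset.Icc (S.min' h) (S.max' h) := fun l hl =>
    Finset.mem_Icc.2 ⟨S.min'_le l hl, S.le_max' l hl⟩
  have h4 := Finset.card_le_card h3
  have h5 := S.min'_le _ (S.max'_mem h)
  rw [Nat.card_Icc] at h4
  have h6 : S.card + S.min' h ≤ S.max' h + 1 := by omega
  have h7 : (S.card : ℝ) + S.min' h ≤ S.max' h + 1 := by exact_mod_cast h6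
  rw [abs_lt] at h1 h2
  linarith [h1.1, h2.2]

lemma abs_one_sub_le_abs_cos {x : ℝ} (h0 : 0 ≤ x) (h1 : x ≤ Real.pi) :
    |1 - 2 / Real.pi * x| ≤ |Real.cos x| := by
  have hpi := Real.pi_pos
  rcases le_total x (Real.pi / 2) with h | h
  · rw [abs_of_nonneg]
    · exact (Real.one_sub_mul_le_cos h0 h).trans (le_abs_self _)
    · rw [sub_nonneg, div_mul_eq_mul_div, div_le_one hpi]; linarith
  · have h2 := Real.one_sub_mul_le_cos (x := Real.pi - x) (by linarith) (by linarith)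
    rw [Real.cos_pi_sub] at h2
    have h3 : 1 - 2 / Real.pi * (Real.pi - x) = -(1 - 2 / Real.pi * x) := by
      field_simp; ring
    rw [h3] at h2
    rw [abs_of_nonpos]
    · exact h2.trans (neg_le_abs _)
    · rw [sub_nonpos, div_mul_eq_mul_div, one_le_div hpi]; linarith

lemma cos_pi_mul_block {M : ℕ} (hM : 0 < M) {σ : ℝ} (hσ : 0 < σ) (j l : ℕ) :
    (-1) ^ j * Real.cos (Real.pi * ((j * M + l : ℕ) * (σ / M)) / σ) =
      Real.cos (Real.pi * l / M) := by
  have hM' : (0 : ℝ) < M := by exact_mod_cast hM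
  have : Real.pi * ((j * M + l : ℕ) * (σ / M)) / σ = Real.pi * l / M + j * Real.pi := by
    push_cast; field_simp; ring
  rw [this, Real.cos_add_nat_mul_pi, ← mul_assoc, ← mul_pow]
  simp

lemma neg_one_pow_mul_cos_sub_nonpos {M : ℕ} (hM : 0 < M) {σ : ℝ} (hσ : 0 < σ) (j : ℕ) {l : ℕ}
    (hl : l < M) :
    (-1) ^ j * (Real.cos (Real.pi * ((j * M + l + 1 : ℕ) * (σ / M)) / σ) -
      Real.cos (Real.pi * ((j * M + l : ℕ) * (σ / M)) / σ)) ≤ 0 := by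
  have hM' : (0 : ℝ) < M := by exact_mod_cast hM
  have hpi := Real.pi_pos
  rw [mul_sub, cos_pi_mul_block hM hσ, add_assoc, cos_pi_mul_block hM hσ, sub_nonpos]
  have hl' : ((l + 1 : ℕ) : ℝ) ≤ M := by exact_mod_cast hl
  refine Real.cos_le_cos_of_nonneg_of_le_pi (by positivity) ?_ ?_
  · rw [div_le_iff₀ hM']; gcongr
  · gcongr; omega

lemma le_abs_cos_add_cos {M : ℕ} (hM : 0 < M) {σ : ℝ} (hσ : 0 < σ) (j : ℕ) {l : ℕ} (hl : l < M) :
    |1 - 2 * (l : ℝ) / M| - 2 / M ≤ |(Real.cos (Real.pi * ((j * M + l : ℕ) * (σ / M)) / σ) +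
      Real.cos (Real.pi * ((j * M + l + 1 : ℕ) * (σ / M)) / σ)) / 2| := by
  have hM' : (0 : ℝ) < M := by exact_mod_cast hM
  have hpi := Real.pi_pos
  have hl' : (l : ℝ) ≤ M := by exact_mod_cast hl.le
  have h1 : |(Real.cos (Real.pi * ((j * M + l : ℕ) * (σ / M)) / σ) +
      Real.cos (Real.pi * ((j * M + l + 1 : ℕ) * (σ / M)) / σ)) / 2| =
      |(Real.cos (Real.pi * l / M) + Real.cos (Real.pi * (l + 1 : ℕ) / M)) / 2| := by
    rw [← cos_pi_mul_block hM hσ j l, ← cos_pi_mul_block hM hσ j (l + 1), ← mul_add,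
      mul_div_assoc ((-1 : ℝ) ^ j),
      abs_mul, abs_pow, abs_neg, abs_one, one_pow, one_mul, add_assoc]
  have h2 := abs_one_sub_le_abs_cos (x := Real.pi * l / M) (by positivity)
    (by rw [div_le_iff₀ hM']; gcongr)
  have h3 : 2 / Real.pi * (Real.pi * l / M) = 2 * l / M := by field_simp
  rw [h3] at h2
  have h4 : |Real.cos (Real.pi * (l + 1 : ℕ) / M) - Real.cos (Real.pi * l / M)| ≤ 4 / M := by
    have := Real.abs_cos_sub_cos_le (Real.pi * (l + 1 : ℕ) / M) (Real.pi * l / M)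
    refine this.trans ?_
    have : Real.pi * (l + 1 : ℕ) / M - Real.pi * l / M = Real.pi / M := by push_cast; ring
    rw [this, abs_of_nonneg (by positivity)]
    gcongr
    exact Real.pi_le_four
  rw [h1]
  set a := Real.cos (Real.pi * l / M)
  set b := Real.cos (Real.pi * (l + 1 : ℕ) / M)
  have h5 : |a| ≤ |(a + b) / 2| + |(b - a) / 2| := by
    have := abs_sub ((a + b) / 2) ((b - a) / 2)
    rwa [show (a + b) / 2 - (b - a) / 2 = a by ring] at this
  rw [abs_div (b - a), abs_two] at h5
  have : (4 : ℝ) / M / 2 = 2 / M := by ring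
  linarith

namespace IsSGP

variable {Ω : Type*} [MeasurableSpace Ω] {P : Measure Ω} [IsProbabilityMeasure P] {μ : Measure ℝ}
  [IsProbabilityMeasure μ] {F : ℝ → Ω → ℝ} {Λ σ A K : ℝ} {h : ℝ → ℝ}

lemma abs_mean_add_le_of_isUpStep {f : ℝ → ℝ} {M j l : ℕ} (hM : 0 < M) (hσ : 0 < σ) (hl : l < M)
    (hA : 0 ≤ A)
    (hh' : |(h ((j * M + l + 1 : ℕ) * (σ / M)) -
      A * Real.cos (Real.pi * ((j * M + l + 1 : ℕ) * (σ / M)) / σ)) -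
      (h ((j * M + l : ℕ) * (σ / M)) -
      A * Real.cos (Real.pi * ((j * M + l : ℕ) * (σ / M)) / σ))| ≤ σ / M)
    (hup : IsUpStep (fun i => f (i * (σ / M)) + h (i * (σ / M))) M j l) :
    |(f ((j * M + l : ℕ) * (σ / M)) + f ((j * M + l : ℕ) * (σ / M) + σ / M)) / 2 +
      (h ((j * M + l : ℕ) * (σ / M)) + h ((j * M + l + 1 : ℕ) * (σ / M))) / 2| ≤
      |f ((j * M + l : ℕ) * (σ / M) + σ / M) - f ((j * M + l : ℕ) * (σ / M))| + σ / M := by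
  have hcos := mul_nonpos_of_nonneg_of_nonpos hA (neg_one_pow_mul_cos_sub_nonpos hM hσ j hl)
  have e : (j * M + l : ℕ) * (σ / M) + σ / M = (j * M + l + 1 : ℕ) * (σ / M) := by
    push_cast; ring
  obtain ⟨h1, h2⟩ := hup
  rw [e]
  have hτ : 0 < σ / M := by positivity
  set t := (j * M + l : ℕ) * (σ / M)
  set t' := (j * M + l + 1 : ℕ) * (σ / M)
  have hV1 := le_abs_self (f t' - f t)
  have hV2 := neg_le_abs (f t' - f t)
  obtain ⟨h3, h4⟩ := abs_le.1 hh'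
  rcases neg_one_pow_eq_or ℝ j with hj | hj <;> rw [hj] at h1 h2 hcos <;> rw [abs_le] <;>
    constructor <;> linarith

lemma sum_measure_isUpStep_le (hF : IsSGP P μ F) (hΛ : ∀ s, 1 - Λ * s ^ 2 / 2 ≤ covKernel μ s)
    (hΛ0 : 0 ≤ Λ) (hσ : 0 < σ) (hA : 0 < A) (hK : 0 < K) {M : ℕ} (hM : 0 < M)
    (hΛM : Λ * (σ / M) ^ 2 ≤ 1) (hAM : 2 * A ≤ M) (j : ℕ)
    (hh : ∀ t ∈ Icc (j * σ) ((j + 1) * σ), |h t - A * Real.cos (Real.pi * t / σ)| ≤ 1)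
    (hh' : ∀ s ∈ Icc (j * σ) ((j + 1) * σ), ∀ t ∈ Icc (j * σ) ((j + 1) * σ),
      |(h t - A * Real.cos (Real.pi * t / σ)) - (h s - A * Real.cos (Real.pi * s / σ))| ≤ |t - s|) :
    ∑ l ∈ Finset.range M, P {ω | IsUpStep (fun i => F (i * (σ / M)) ω + h (i * (σ / M))) M j l} ≤
      ENNReal.ofReal (((2 * K + 2) / A + 1 / M + Real.exp (-K ^ 2 / 2)) * ((Λ + 3) * σ) +
        (2 * Λ + 2) * σ ^ 2 / (K ^ 2 * M)) := by
  have hM' : (0 : ℝ) < M := by exact_mod_cast hM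
  have hτ : 0 < σ / M := by positivity
  set ρ := (2 * K + 2) / A with hρ
  set c₁ := (Λ + 3) * (σ / M) with hc₁
  set c₂ := Real.exp (-K ^ 2 / 2) * ((Λ + 3) * (σ / M)) + 1 / K ^ 2 * ((2 * Λ + 2) * (σ / M) ^ 2)
    with hc₂
  have hmem : ∀ l, l ≤ M → ((j * M + l : ℕ) : ℝ) * (σ / M) ∈ Icc (j * σ) ((j + 1) * σ) := by
    intro l hl
    have hl' : (l : ℝ) ≤ M := by exact_mod_cast hl
    have e : ((j * M + l : ℕ) : ℝ) * (σ / M) = j * σ + l * (σ / M) := by push_cast; field_simp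
    have h1 : l * (σ / M) ≤ M * (σ / M) := by gcongr
    rw [mul_div_cancel₀ _ hM'.ne'] at h1
    have h2 : 0 ≤ l * (σ / M) := by positivity
    rw [e]
    constructor <;> linarith
  have hterm : ∀ l ∈ Finset.range M,
      P {ω | IsUpStep (fun i => F (i * (σ / M)) ω + h (i * (σ / M))) M j l} ≤
      ENNReal.ofReal ((if |(l : ℝ) - M / 2| < ρ * M / 2 then c₁ else 0) + c₂) := by
    intro l hl
    rw [Finset.mem_range] at hl
    have hs := hmem l hl.le
    have ht := hmem (l + 1) hl
    rw [← add_assoc] at ht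
    have hup : ∀ ω, IsUpStep (fun i => F (i * (σ / M)) ω + h (i * (σ / M))) M j l → _ :=
      fun ω hω => abs_mean_add_le_of_isUpStep (f := fun t => F t ω) hM hσ hl hA.le
        ((hh' _ hs _ ht).trans (le_of_eq (by
          rw [← sub_mul]; push_cast; rw [add_sub_cancel_left, one_mul, abs_of_pos hτ]))) hω
    split_ifs with hlt
    · refine (measure_mono hup).trans ((hF.measure_abs_mean_add_le hΛ hτ hΛM _ _).trans
        (ENNReal.ofReal_le_ofReal ?_))
      exact le_add_of_nonneg_right (by positivity)
    · refine (measure_mono hup).trans ((hF.measure_abs_mean_add_le_of_le_abs hΛ hτ hΛM _ hK ?_).trans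
        (ENNReal.ofReal_le_ofReal (by rw [zero_add])))
      have h1 := le_abs_cos_add_cos hM hσ j hl
      have h2 : ρ ≤ |1 - 2 * (l : ℝ) / M| := by
        have : |1 - 2 * (l : ℝ) / M| = |(l : ℝ) - M / 2| * (2 / M) := by
          rw [show 1 - 2 * (l : ℝ) / M = -((l - M / 2) * (2 / M)) by field_simp; ring, abs_neg,
            abs_mul, abs_of_pos (show (0 : ℝ) < 2 / M by positivity)]
        rw [this]
        rw [not_lt] at hlt
        calc ρ = ρ * M / 2 * (2 / M) := by field_simp
          _ ≤ _ := by gcongr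
      have h3 := hh _ hs
      have h4 := hh _ ht
      set C := Real.cos (Real.pi * ((j * M + l : ℕ) * (σ / M)) / σ)
      set C' := Real.cos (Real.pi * ((j * M + l + 1 : ℕ) * (σ / M)) / σ)
      set t := (j * M + l : ℕ) * (σ / M)
      set t' := (j * M + l + 1 : ℕ) * (σ / M)
      have h5 : A * |(C + C') / 2| ≤ |(h t + h t') / 2| + 1 := by
        have h6 : A * |(C + C') / 2| = |A * ((C + C') / 2)| := by rw [abs_mul, abs_of_pos hA]
        have h7 := abs_sub ((h t + h t') / 2) (((h t - A * C) + (h t' - A * C')) / 2)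
        have h8 : |((h t - A * C) + (h t' - A * C')) / 2| ≤ 1 := by
          rw [abs_div, abs_two, div_le_one (by norm_num)]
          exact (abs_add_le _ _).trans (by linarith)
        rw [show (h t + h t') / 2 - ((h t - A * C) + (h t' - A * C')) / 2 = A * ((C + C') / 2) by
          ring] at h7
        linarith
      have h9 : A * (ρ - 2 / M) ≤ A * |(C + C') / 2| := by gcongr; linarith
      have h10 : A * ρ = 2 * K + 2 := by rw [hρ]; field_simp
      have h11 : A * (2 / M) ≤ 1 := by
        rw [← mul_div_assoc, div_le_one hM']; linarith
      nlinarith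
  refine (Finset.sum_le_sum hterm).trans ?_
  have hρ0 : 0 < ρ := by positivity
  rw [← ENNReal.ofReal_sum_of_nonneg fun l _ => by split_ifs <;> positivity]
  refine ENNReal.ofReal_le_ofReal ?_
  rw [Finset.sum_add_distrib, ← Finset.sum_filter, Finset.sum_const, Finset.sum_const,
    Finset.card_range, nsmul_eq_mul, nsmul_eq_mul]
  have hcard := card_filter_abs_sub_lt_le (Finset.range M) (M / 2) (r := ρ * M / 2) (by positivity)
  calc _ ≤ (2 * (ρ * M / 2) + 1) * c₁ + M * c₂ := by gcongr
    _ = _ := by rw [hc₁, hc₂]; field_simp; ring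

end IsSGP

lemma isUpStep_congr {x y : ℕ → ℝ} {M n j l : ℕ} (h : ∀ i ≤ n * M, x i = y i) (hj : j < n)
    (hl : l < M) : IsUpStep x M j l ↔ IsUpStep y M j l := by
  have : j * M + l + 1 ≤ n * M := by
    have : (j + 1) * M ≤ n * M := Nat.mul_le_mul_right M hj
    rw [add_mul, one_mul] at this
    omega
  rw [IsUpStep, IsUpStep, h _ this, h _ (by omega)]

lemma upCount_congr {x y : ℕ → ℝ} {M n : ℕ} (h : ∀ i ≤ n * M, x i = y i) :
    upCount x M n = upCount y M n :=
  Finset.sum_congr rfl fun _ hj => congrArg Finset.card <| Finset.filter_congr fun _ hl =>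
    isUpStep_congr h (Finset.mem_range.1 hj) (Finset.mem_range.1 hl)

lemma badCount_congr {x y : ℕ → ℝ} {M n : ℕ} (h : ∀ i ≤ n * M, x i = y i) :
    badCount x M n = badCount y M n :=
  congrArg Finset.card <| Finset.filter_congr fun j hj => by
    rw [h _ (Nat.mul_le_mul_right M (Nat.lt_succ_iff.1 (Finset.mem_range.1 hj)))]

lemma measurableSet_isUpStep (M j l : ℕ) : MeasurableSet {x : ℕ → ℝ | IsUpStep x M j l} :=
  (measurableSet_lt (by fun_prop : Measurable fun x : ℕ → ℝ => (-1) ^ j * x (j * M + l))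
    measurable_const).inter (measurableSet_le measurable_const
      (by fun_prop : Measurable fun x : ℕ → ℝ => (-1) ^ j * x (j * M + l + 1)))

lemma measurableSet_bad (M j : ℕ) : MeasurableSet {x : ℕ → ℝ | (-1) ^ j * x (j * M) ≤ 0} :=
  measurableSet_le (by fun_prop) measurable_const

lemma natCast_upCount (x : ℕ → ℝ) (M n : ℕ) : (upCount x M n : ℝ≥0∞) =
    ∑ j ∈ Finset.range n, ∑ l ∈ Finset.range M,
      {x : ℕ → ℝ | IsUpStep x M j l}.indicator 1 x := by
  simp only [upCount, Finset.card_filter, indicator_apply, Nat.cast_sum, Nat.cast_ite, Nat.cast_one,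
    Nat.cast_zero, mem_ofPred_eq, Pi.one_apply]

lemma natCast_badCount (x : ℕ → ℝ) (M n : ℕ) : (badCount x M n : ℝ≥0∞) =
    ∑ j ∈ Finset.range (n + 1), {x : ℕ → ℝ | (-1) ^ j * x (j * M) ≤ 0}.indicator 1 x := by
  simp only [badCount, Finset.card_filter, indicator_apply, Nat.cast_sum, Nat.cast_ite,
    Nat.cast_one, Nat.cast_zero, mem_ofPred_eq, Pi.one_apply]

lemma measurable_natCast_upCount (M n : ℕ) :
    Measurable fun x : ℕ → ℝ => (upCount x M n : ℝ≥0∞) := by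
  simp_rw [natCast_upCount]
  exact Finset.measurable_fun_sum _ fun j _ => Finset.measurable_fun_sum _ fun l _ =>
    measurable_one.indicator (measurableSet_isUpStep M j l)

lemma measurable_natCast_badCount (M n : ℕ) :
    Measurable fun x : ℕ → ℝ => (badCount x M n : ℝ≥0∞) := by
  simp_rw [natCast_badCount]
  exact Finset.measurable_fun_sum _ fun j _ => measurable_one.indicator (measurableSet_bad M j)

lemma lintegral_upCount (ν : Measure (ℕ → ℝ)) (M n : ℕ) : ∫⁻ x, (upCount x M n : ℝ≥0∞) ∂ν =
    ∑ j ∈ Finset.range n, ∑ l ∈ Finset.range M, ν {x | IsUpStep x M j l} := by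
  simp_rw [natCast_upCount]
  have hm := fun j l => measurable_one.indicator (β := ℝ≥0∞) (measurableSet_isUpStep M j l)
  rw [lintegral_finsetSum _ fun j _ => Finset.measurable_fun_sum _ fun l _ => hm j l]
  refine Finset.sum_congr rfl fun j _ => ?_
  rw [lintegral_finsetSum _ fun l _ => hm j l]
  exact Finset.sum_congr rfl fun l _ => lintegral_indicator_one (measurableSet_isUpStep M j l)

lemma lintegral_badCount (ν : Measure (ℕ → ℝ)) (M n : ℕ) : ∫⁻ x, (badCount x M n : ℝ≥0∞) ∂ν =
    ∑ j ∈ Finset.range (n + 1), ν {x | (-1) ^ j * x (j * M) ≤ 0} := by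
  simp_rw [natCast_badCount]
  rw [lintegral_finsetSum _ fun j _ => measurable_one.indicator (measurableSet_bad M j)]
  exact Finset.sum_congr rfl fun l _ => lintegral_indicator_one (measurableSet_bad M l)

/-- Sequences with fewer than `r` up-steps and fewer than `r` bad block endpoints. -/
def fewDefects (M n : ℕ) (r : ℝ≥0∞) : Set (ℕ → ℝ) :=
  {x | (upCount x M n : ℝ≥0∞) < r ∧ (badCount x M n : ℝ≥0∞) < r}

lemma measurableSet_fewDefects (M n : ℕ) (r : ℝ≥0∞) : MeasurableSet (fewDefects M n r) :=
  (measurableSet_lt (measurable_natCast_upCount M n) measurable_const).inter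
    (measurableSet_lt (measurable_natCast_badCount M n) measurable_const)

lemma three_quarters_le_measure_fewDefects {ν : Measure (ℕ → ℝ)} [IsProbabilityMeasure ν]
    {M n : ℕ} {r : ℝ≥0∞} (hr : r ≠ 0) (hr' : r ≠ ∞)
    (h₁ : ∑ j ∈ Finset.range n, ∑ l ∈ Finset.range M, ν {x | IsUpStep x M j l} ≤ r / 8)
    (h₂ : ∑ j ∈ Finset.range (n + 1), ν {x | (-1) ^ j * x (j * M) ≤ 0} ≤ r / 8) :
    3 / 4 ≤ ν (fewDefects M n r) := by
  have key : ∀ f : (ℕ → ℝ) → ℝ≥0∞, Measurable f → ∫⁻ x, f x ∂ν ≤ r / 8 → ν {x | r ≤ f x} ≤ 1 / 8 := by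
    intro f hf h
    refine (meas_ge_le_lintegral_div hf.aemeasurable hr hr').trans ?_
    rw [ENNReal.div_le_iff hr hr', one_div, mul_comm, ← div_eq_mul_inv]
    exact h
  have h3 := key _ (measurable_natCast_upCount M n) (by rwa [lintegral_upCount])
  have h4 := key _ (measurable_natCast_badCount M n) (by rwa [lintegral_badCount])
  have h5 : (fewDefects M n r)ᶜ ⊆ {x | r ≤ (upCount x M n : ℝ≥0∞)} ∪
      {x | r ≤ (badCount x M n : ℝ≥0∞)} := by
    intro x hx
    by_contra hcon
    simp only [mem_union, mem_ofPred_eq, not_or, not_le] at hcon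
    exact hx hcon
  have h6 : ν (fewDefects M n r)ᶜ ≤ 1 / 8 + 1 / 8 :=
    (measure_mono h5).trans ((measure_union_le _ _).trans (add_le_add h3 h4))
  have h7 := measure_add_measure_compl (μ := ν) (measurableSet_fewDefects M n r)
  rw [measure_univ] at h7
  have h8 : (1 : ℝ≥0∞) / 8 + 1 / 8 = 1 / 4 := by
    rw [← ENNReal.toReal_eq_toReal_iff' (by finiteness) (by finiteness)]
    rw [ENNReal.toReal_add (by finiteness) (by finiteness)]
    norm_num
  have h9 : (3 : ℝ≥0∞) / 4 + 1 / 4 = 1 := by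
    rw [← ENNReal.toReal_eq_toReal_iff' (by finiteness) (by finiteness)]
    rw [ENNReal.toReal_add (by finiteness) (by finiteness)]
    norm_num
  rw [h8] at h6
  have h10 : (3 : ℝ≥0∞) / 4 + 1 / 4 ≤ ν (fewDefects M n r) + 1 / 4 :=
    (h9.trans h7.symm).trans_le (add_le_add le_rfl h6)
  exact (ENNReal.add_le_add_iff_right (by finiteness)).1 h10

namespace IsSGP

variable {Ω : Type*} [MeasurableSpace Ω] {P : Measure Ω} [IsProbabilityMeasure P] {μ : Measure ℝ}
  [IsProbabilityMeasure μ] {F : ℝ → Ω → ℝ}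

lemma exp_mul_measure_shift_le (hF : IsSGP P μ F) {A : ℝ} (hA : 0 < A) {I : Set ℝ}
    (hI : 0 < μ.real I) (τ : ℝ) (M n : ℕ) (r : ℝ≥0∞) :
    ENNReal.ofReal (Real.exp (-(A ^ 2 / μ.real I) / 2)) *
        P {ω | (fun i : ℕ => F (i * τ) ω + A / μ.real I * ∫ l in I, Real.cos (l * (i * τ)) ∂μ) ∈
          fewDefects M n r} ≤
      P {ω | (fun i : ℕ => F (i * τ) ω) ∈ fewDefects M n r} +
        ENNReal.ofReal (Real.exp (-(A ^ 2 / μ.real I) / 2)) * (1 / 2) := by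
  set m := μ.real I
  let ext : (Fin (n * M + 1) → ℝ) → ℕ → ℝ := fun y i => y (Fin.ofNat (n * M + 1) i)
  have hext : Measurable ext := by fun_prop
  have hB := hext (measurableSet_fewDefects M n r)
  have hmem : ∀ x : ℕ → ℝ, ext (fun i => x i) ∈ fewDefects M n r ↔ x ∈ fewDefects M n r := by
    intro x
    have h : ∀ i ≤ n * M, ext (fun i => x i) i = x i := fun i hi => by
      simp [ext, Nat.mod_eq_of_lt (Nat.lt_succ_of_le hi)]
    simp only [fewDefects, mem_ofPred_eq]
    rw [upCount_congr h, badCount_congr h]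
  set t : Fin (n * M + 1) → ℝ := fun i => i * τ with ht
  have := Measure.isProbabilityMeasure_map (μ := P) (hF.aemeasurable_pi t)
  have hs : (A / √m) ^ 2 = A ^ 2 / m := by rw [div_pow, Real.sq_sqrt hI.le]
  have hle := (hF.isCenteredGaussian t).exp_mul_shift_le (covMatrix_isHermitian μ t)
    (fun i => A / m * ∫ l in I, Real.cos (l * (i * τ)) ∂μ) (s := A / √m) (by positivity)
    (fun a => ?_) hB
  · rw [neg_div, hs, ← neg_div] at hle
    have e1 : MeasurableSet {x : Fin (n * M + 1) → ℝ |
        (fun i => x i + A / m * ∫ l in I, Real.cos (l * (i * τ)) ∂μ) ∈ ext ⁻¹' fewDefects M n r} :=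
      (by fun_prop : Measurable fun (x : Fin (n * M + 1) → ℝ) i =>
        x i + A / m * ∫ l in I, Real.cos (l * (i * τ)) ∂μ) hB
    rw [Measure.map_apply_of_aemeasurable (hF.aemeasurable_pi t) e1,
      Measure.map_apply_of_aemeasurable (hF.aemeasurable_pi t) hB] at hle
    have e2 : {ω | (fun i : ℕ => F (i * τ) ω + A / m * ∫ l in I, Real.cos (l * (i * τ)) ∂μ) ∈
        fewDefects M n r} = (fun ω i => F (t i) ω) ⁻¹' {x : Fin (n * M + 1) → ℝ |
        (fun i => x i + A / m * ∫ l in I, Real.cos (l * (i * τ)) ∂μ) ∈ ext ⁻¹' fewDefects M n r} :=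
      Set.ext fun ω => (hmem fun i => _).symm
    have e3 : {ω | (fun i : ℕ => F (i * τ) ω) ∈ fewDefects M n r} =
        (fun ω i => F (t i) ω) ⁻¹' (ext ⁻¹' fewDefects M n r) :=
      Set.ext fun ω => (hmem fun i => _).symm
    rwa [e2, e3]
  · have h := sq_dotProduct_setIntegral_cos_le μ t 0 I a
    have e : (a ⬝ᵥ fun i : Fin (n * M + 1) => A / m * ∫ l in I, Real.cos (l * (i * τ)) ∂μ) =
        A / m * (a ⬝ᵥ fun i => ∫ l in I, Real.cos (l * (t i - 0)) ∂μ) := by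
      simp only [dotProduct, Finset.mul_sum, sub_zero, ht]
      exact Finset.sum_congr rfl fun i _ => by ring
    rw [e, mul_pow, hs]
    calc _ ≤ (A / m) ^ 2 * (m * (a ⬝ᵥ covMatrix μ t *ᵥ a)) := by gcongr
      _ = _ := by field_simp

end IsSGP

lemma le_measure_frequently {α : Type*} [MeasurableSpace α] {ν : Measure α} [IsProbabilityMeasure ν]
    {E : ℕ → Set α} (hE : ∀ m, NullMeasurableSet (E m) ν) {p : ℝ≥0∞} (hp1 : p ≤ 1)
    (h : ∀ᶠ m in Filter.atTop, p ≤ ν (E m)) : p ≤ ν {x | ∃ᶠ m in Filter.atTop, x ∈ E m} := by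
  have h1 : ν {x | ∃ᶠ m in Filter.atTop, x ∈ E m}ᶜ ≤ 1 - p := by
    refine measure_le_of_forall_eventually_mem (G := fun m => (E m)ᶜ)
      (fun x hx => Filter.not_frequently.1 hx) ?_
    filter_upwards [h] with m hm
    rw [prob_compl_eq_one_sub₀ (hE m)]
    gcongr
  have h2 : 1 ≤ ν {x | ∃ᶠ m in Filter.atTop, x ∈ E m} + (1 - p) := by
    have e : ν ({x | ∃ᶠ m in Filter.atTop, x ∈ E m} ∪ {x | ∃ᶠ m in Filter.atTop, x ∈ E m}ᶜ) = 1 := by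
      rw [union_compl_self, measure_univ]
    exact e.ge.trans ((measure_union_le _ _).trans (add_le_add le_rfl h1))
  rw [← ENNReal.add_le_add_iff_right (a := 1 - p) (by finiteness), add_tsub_cancel_of_le hp1]
  exact h2

namespace IsSGP

variable {Ω : Type*} [MeasurableSpace Ω] {P : Measure Ω} [IsProbabilityMeasure P] {μ : Measure ℝ}
  [IsProbabilityMeasure μ] {F : ℝ → Ω → ℝ} {Λ σ A K : ℝ} {h : ℝ → ℝ}

lemma three_quarters_le_measure_shift (hF : IsSGP P μ F)
    (hΛ : ∀ s, 1 - Λ * s ^ 2 / 2 ≤ covKernel μ s) (hΛ0 : 0 ≤ Λ) (hσ : 0 < σ) (hA : 1 < A)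
    (hK : 0 < K) {n : ℕ} {r κ : ℝ} (hr : 0 < r) (hκr : n * κ ≤ r / 8)
    (hκ : ((2 * K + 2) / A + Real.exp (-K ^ 2 / 2)) * ((Λ + 3) * σ) < κ)
    (hAr : (n + 1) * (1 / (A - 1) ^ 2) ≤ r / 8)
    (hh : ∀ t ∈ Icc 0 (n * σ), |h t - A * Real.cos (Real.pi * t / σ)| ≤ 1)
    (hh' : ∀ s ∈ Icc 0 (n * σ), ∀ t ∈ Icc 0 (n * σ),
      |(h t - A * Real.cos (Real.pi * t / σ)) - (h s - A * Real.cos (Real.pi * s / σ))| ≤ |t - s|) :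
    ∀ᶠ M : ℕ in Filter.atTop, 3 / 4 ≤ P {ω | (fun i : ℕ => F (i * (σ / M)) ω + h (i * (σ / M))) ∈
      fewDefects M n (ENNReal.ofReal r)} := by
  have hlim1 : Filter.Tendsto (fun M : ℕ => ((2 * K + 2) / A + 1 / M + Real.exp (-K ^ 2 / 2)) *
      ((Λ + 3) * σ) + (2 * Λ + 2) * σ ^ 2 / (K ^ 2 * M)) Filter.atTop
      (nhds (((2 * K + 2) / A + 0 + Real.exp (-K ^ 2 / 2)) * ((Λ + 3) * σ) +
        (2 * Λ + 2) * σ ^ 2 / K ^ 2 * 0)) := by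
    refine Filter.Tendsto.add (((tendsto_const_nhds.add
      tendsto_one_div_atTop_nhds_zero_nat).add tendsto_const_nhds).mul tendsto_const_nhds) ?_
    refine (tendsto_one_div_atTop_nhds_zero_nat.const_mul _).congr fun M => ?_
    rw [div_mul_div_comm, mul_one]
  rw [add_zero, mul_zero, add_zero] at hlim1
  have hlim2 : Filter.Tendsto (fun M : ℕ => Λ * (σ / M) ^ 2) Filter.atTop (nhds (Λ * 0 ^ 2)) :=
    ((tendsto_const_div_atTop_nhds_zero_nat σ).pow 2).const_mul _
  filter_upwards [hlim1.eventually_lt_const hκ, hlim2.eventually_lt_const (show Λ * 0 ^ 2 < 1 by norm_num),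
    Filter.eventually_gt_atTop 0, Filter.eventually_ge_atTop ⌈2 * A⌉₊] with M h1 h2 hM hAM
  have hM' : (0 : ℝ) < M := by exact_mod_cast hM
  have hAM' : 2 * A ≤ M := Nat.ceil_le.1 hAM
  have hY : AEMeasurable (fun ω (i : ℕ) => F (i * (σ / M)) ω + h (i * (σ / M))) P :=
    aemeasurable_pi_lambda _ fun i => (hF.aemeasurable _).add_const _
  have hmono : ∀ j, j < n → ∀ t, t ∈ Icc (j * σ) ((j + 1) * σ) → t ∈ Icc 0 (n * σ) := by
    intro j hj t ht
    have h3 : ((j : ℝ) + 1) ≤ n := by exact_mod_cast hj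
    exact ⟨le_trans (by positivity) ht.1, ht.2.trans (by gcongr)⟩
  have := Measure.isProbabilityMeasure_map hY
  have e8 : ENNReal.ofReal (r / 8) = ENNReal.ofReal r / 8 := by
    rw [ENNReal.ofReal_div_of_pos (by norm_num)]; norm_num
  have key := three_quarters_le_measure_fewDefects
    (ν := P.map (fun ω (i : ℕ) => F (i * (σ / M)) ω + h (i * (σ / M)))) (M := M) (n := n)
    (r := ENNReal.ofReal r) (by simpa using hr) ENNReal.ofReal_ne_top ?_ ?_
  · rwa [Measure.map_apply_of_aemeasurable hY (measurableSet_fewDefects _ _ _)] at key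
  · rw [← e8]
    calc _ ≤ ∑ j ∈ Finset.range n, ENNReal.ofReal κ := by
          refine Finset.sum_le_sum fun j hj => ?_
          rw [Finset.mem_range] at hj
          refine le_trans (le_of_eq ?_) ((hF.sum_measure_isUpStep_le hΛ hΛ0 hσ (by linarith) hK hM
            h2.le hAM' j (fun t ht => hh t (hmono j hj t ht)) fun s hs t ht =>
              hh' s (hmono j hj s hs) t (hmono j hj t ht)).trans (ENNReal.ofReal_le_ofReal h1.le))
          refine Finset.sum_congr rfl fun l _ => ?_
          rw [Measure.map_apply_of_aemeasurable hY (measurableSet_isUpStep _ _ _)]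
          rfl
      _ = ENNReal.ofReal (n * κ) := by
          rw [Finset.sum_const, Finset.card_range, nsmul_eq_mul, ENNReal.ofReal_mul (by positivity),
            ENNReal.ofReal_natCast]
      _ ≤ _ := ENNReal.ofReal_le_ofReal hκr
  · rw [← e8]
    calc _ ≤ ∑ j ∈ Finset.range (n + 1), ENNReal.ofReal (1 / (A - 1) ^ 2) := by
          refine Finset.sum_le_sum fun j hj => ?_
          rw [Measure.map_apply_of_aemeasurable hY (measurableSet_bad _ _)]
          refine (measure_mono fun ω hω => ?_).trans
            (hF.measure_le_abs_le (j * σ) (by linarith : 0 < A - 1))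
          have e : ((j * M : ℕ) : ℝ) * (σ / M) = j * σ := by push_cast; field_simp
          simp only [mem_preimage, mem_ofPred_eq, e] at hω ⊢
          have hjn : (j : ℝ) ≤ n := by exact_mod_cast Nat.lt_succ_iff.1 (Finset.mem_range.1 hj)
          have h3 := hh (j * σ) ⟨by positivity, by gcongr⟩
          rw [show Real.pi * (j * σ) / σ = j * Real.pi by field_simp, Real.cos_nat_mul_pi] at h3
          obtain ⟨h4, h5⟩ := abs_le.1 h3
          have h6 := le_abs_self (F (j * σ) ω)
          have h7 := neg_le_abs (F (j * σ) ω)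
          rcases neg_one_pow_eq_or ℝ j with hj | hj <;> rw [hj] at hω h4 h5 <;> linarith
      _ = ENNReal.ofReal ((n + 1) * (1 / (A - 1) ^ 2)) := by
          rw [Finset.sum_const, Finset.card_range, nsmul_eq_mul, ENNReal.ofReal_mul (by positivity)]
          congr 1
          rw [← Nat.cast_add_one, ENNReal.ofReal_natCast]
      _ ≤ _ := ENNReal.ofReal_le_ofReal hAr

lemma exp_div_four_le_measure_frequently (hF : IsSGP P μ F)
    (hΛ : ∀ s, 1 - Λ * s ^ 2 / 2 ≤ covKernel μ s) (hΛ0 : 0 ≤ Λ) (hσ : 0 < σ) (hA : 1 < A)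
    (hK : 0 < K) {n : ℕ} {r κ : ℝ} (hr : 0 < r) (hκr : n * κ ≤ r / 8)
    (hκ : ((2 * K + 2) / A + Real.exp (-K ^ 2 / 2)) * ((Λ + 3) * σ) < κ)
    (hAr : (n + 1) * (1 / (A - 1) ^ 2) ≤ r / 8) {I : Set ℝ} (hI : 0 < μ.real I)
    (hhI : ∀ t, h t = A / μ.real I * ∫ l in I, Real.cos (l * t) ∂μ)
    (hh : ∀ t ∈ Icc 0 (n * σ), |h t - A * Real.cos (Real.pi * t / σ)| ≤ 1)
    (hh' : ∀ s ∈ Icc 0 (n * σ), ∀ t ∈ Icc 0 (n * σ),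
      |(h t - A * Real.cos (Real.pi * t / σ)) - (h s - A * Real.cos (Real.pi * s / σ))| ≤ |t - s|) :
    ENNReal.ofReal (Real.exp (-(A ^ 2 / μ.real I) / 2) / 4) ≤
      P {ω | ∃ᶠ M : ℕ in Filter.atTop, (fun i : ℕ => F (i * (σ / M)) ω) ∈
        fewDefects M n (ENNReal.ofReal r)} := by
  set p := Real.exp (-(A ^ 2 / μ.real I) / 2) with hp
  have hp0 : 0 < p := Real.exp_pos _
  have hp1 : p ≤ 1 := Real.exp_le_one_iff.2 (by
    have : 0 ≤ A ^ 2 / μ.real I := by positivity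
    linarith)
  refine le_measure_frequently (E := fun M : ℕ => {ω | (fun i : ℕ => F (i * (σ / M)) ω) ∈
        fewDefects M n (ENNReal.ofReal r)}) (fun M => ?_) ?_ ?_
  · exact (aemeasurable_pi_lambda (fun ω (i : ℕ) => F (i * (σ / M)) ω)
      fun i => hF.aemeasurable _).nullMeasurableSet_preimage (measurableSet_fewDefects _ _ _)
  · rw [← ENNReal.ofReal_one]; exact ENNReal.ofReal_le_ofReal (by linarith)
  · filter_upwards [hF.three_quarters_le_measure_shift hΛ hΛ0 hσ hA hK hr hκr hκ hAr hh hh']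
      with M hM
    have h1 := hF.exp_mul_measure_shift_le (A := A) (by linarith) hI (σ / M) M n (ENNReal.ofReal r)
    simp_rw [hhI] at hM
    rw [← hp] at h1
    set q := P {ω | (fun i : ℕ => F (i * (σ / M)) ω) ∈ fewDefects M n (ENNReal.ofReal r)}
    have h2 : ENNReal.ofReal p * (3 / 4) ≤ q + ENNReal.ofReal p * (1 / 2) :=
      (mul_le_mul' le_rfl hM).trans h1
    have hq : q ≠ ∞ := measure_ne_top _ _
    rw [← ENNReal.toReal_le_toReal (by finiteness) (by finiteness),
      ENNReal.toReal_add hq (by finiteness), ENNReal.toReal_mul, ENNReal.toReal_mul,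
      ENNReal.toReal_ofReal hp0.le] at h2
    norm_num at h2
    rw [ENNReal.ofReal_le_iff_le_toReal hq]
    linarith

end IsSGP

section cosine

variable {l₀ w T l : ℝ}

lemma abs_cos_mul_sub_cos_mul_le (hl : l ∈ Icc l₀ (l₀ + w)) {t : ℝ} (ht : t ∈ Icc 0 T) :
    |Real.cos (l * t) - Real.cos (l₀ * t)| ≤ w * T := by
  refine (Real.abs_cos_sub_cos_le _ _).trans ?_
  rw [← sub_mul, abs_mul, abs_of_nonneg (sub_nonneg.2 hl.1), abs_of_nonneg ht.1]
  exact mul_le_mul (by linarith [hl.2]) ht.2 ht.1 (by linarith [hl.1, hl.2])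

lemma abs_cos_mul_sub_cos_mul_sub_le (hl₀ : 0 ≤ l₀) (hl : l ∈ Icc l₀ (l₀ + w)) {s t : ℝ}
    (hs : s ∈ Icc 0 T) (ht : t ∈ Icc 0 T) :
    |(Real.cos (l * t) - Real.cos (l₀ * t)) - (Real.cos (l * s) - Real.cos (l₀ * s))| ≤
      w * (1 + l₀ * T) * |t - s| := by
  refine Convex.norm_image_sub_le_of_norm_hasDerivWithin_le
    (f := fun t => Real.cos (l * t) - Real.cos (l₀ * t))
    (f' := fun t => -Real.sin (l * t) * (l * 1) - -Real.sin (l₀ * t) * (l₀ * 1))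
    (s := Icc 0 T) (fun u _ => ?_) (fun u hu => ?_) (convex_Icc 0 T) hs ht
  · exact ((((hasDerivAt_id u).const_mul l).cos).sub
      (((hasDerivAt_id u).const_mul l₀).cos)).hasDerivWithinAt
  · have h1 : |Real.sin (l * u) - Real.sin (l₀ * u)| ≤ w * T := by
      refine (Real.abs_sin_sub_sin_le _ _).trans ?_
      rw [← sub_mul, abs_mul, abs_of_nonneg (sub_nonneg.2 hl.1), abs_of_nonneg hu.1]
      exact mul_le_mul (by linarith [hl.2]) hu.2 hu.1 (by linarith [hl.1, hl.2])
    have h2 : -Real.sin (l * u) * (l * 1) - -Real.sin (l₀ * u) * (l₀ * 1) =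
        -((l - l₀) * Real.sin (l * u) + l₀ * (Real.sin (l * u) - Real.sin (l₀ * u))) := by ring
    rw [h2, norm_neg, Real.norm_eq_abs]
    refine (abs_add_le _ _).trans ?_
    rw [abs_mul, abs_mul, abs_of_nonneg (sub_nonneg.2 hl.1), abs_of_nonneg hl₀]
    have h3 := mul_le_mul (by linarith [hl.2] : l - l₀ ≤ w) (Real.abs_sin_le_one (l * u))
      (abs_nonneg _) (by linarith [hl.1, hl.2])
    have h4 := mul_le_mul_of_nonneg_left h1 hl₀
    linarith

variable {μ : Measure ℝ} [IsProbabilityMeasure μ] {I : Set ℝ} {A : ℝ}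

lemma mean_cos_sub_eq (hI : 0 < μ.real I) (t : ℝ) :
    A / μ.real I * ∫ l in I, Real.cos (l * t) ∂μ - A * Real.cos (l₀ * t) =
      A / μ.real I * ∫ l in I, (Real.cos (l * t) - Real.cos (l₀ * t)) ∂μ := by
  rw [integral_sub (integrable_cos_mul μ t).integrableOn (integrable_const _), setIntegral_const, smul_eq_mul,
    mul_sub, ← mul_assoc (A / μ.real I), div_mul_cancel₀ _ hI.ne']

lemma abs_mean_mul_setIntegral_le (hA : 0 ≤ A) (hI : 0 < μ.real I) {g : ℝ → ℝ} {C : ℝ}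
    (hg : ∀ l ∈ I, |g l| ≤ C) : |A / μ.real I * ∫ l in I, g l ∂μ| ≤ A * C := by
  rw [abs_mul, abs_of_nonneg (by positivity)]
  calc _ ≤ A / μ.real I * (C * μ.real I) := by
        gcongr
        exact norm_setIntegral_le_of_norm_le_const (f := g) (measure_lt_top _ _) hg
    _ = A * C := by field_simp

lemma abs_mean_cos_sub_le (hA : 0 ≤ A) (hI : 0 < μ.real I) (hIw : I ⊆ Icc l₀ (l₀ + w)) {t : ℝ}
    (ht : t ∈ Icc 0 T) :
    |A / μ.real I * ∫ l in I, Real.cos (l * t) ∂μ - A * Real.cos (l₀ * t)| ≤ A * (w * T) := by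
  rw [mean_cos_sub_eq hI]
  exact abs_mean_mul_setIntegral_le hA hI fun l hl => abs_cos_mul_sub_cos_mul_le (hIw hl) ht

lemma abs_mean_cos_sub_sub_le (hA : 0 ≤ A) (hI : 0 < μ.real I) (hl₀ : 0 ≤ l₀)
    (hIw : I ⊆ Icc l₀ (l₀ + w)) {s t : ℝ} (hs : s ∈ Icc 0 T) (ht : t ∈ Icc 0 T) :
    |(A / μ.real I * ∫ l in I, Real.cos (l * t) ∂μ - A * Real.cos (l₀ * t)) -
      (A / μ.real I * ∫ l in I, Real.cos (l * s) ∂μ - A * Real.cos (l₀ * s))| ≤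
      A * (w * (1 + l₀ * T) * |t - s|) := by
  have hint (u : ℝ) : IntegrableOn (fun l => Real.cos (l * u) - Real.cos (l₀ * u)) I μ :=
    (integrable_cos_mul μ u).integrableOn.sub (integrable_const _)
  rw [mean_cos_sub_eq hI, mean_cos_sub_eq hI, ← mul_sub, ← integral_sub (hint t) (hint s)]
  exact abs_mean_mul_setIntegral_le hA hI
    fun l hl => abs_cos_mul_sub_cos_mul_sub_le hl₀ (hIw hl) hs ht

end cosine

section pigeonhole

lemma exists_Icc_measure_ge {μ : Measure ℝ} [IsFiniteMeasure μ] {a b w : ℝ} (hab : a < b)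
    (hw : 0 < w) (hwb : w ≤ b - a) :
    ∃ l ∈ Icc a b, w / (2 * (b - a)) * μ.real (Icc a b) ≤ μ.real (Icc l (l + w)) := by
  set N := ⌈(b - a) / w⌉₊ with hN
  have hba : 0 < b - a := sub_pos.2 hab
  have h1 : (b - a) / w ≤ N := Nat.le_ceil _
  have h2 : (N : ℝ) < (b - a) / w + 1 := Nat.ceil_lt_add_one (by positivity)
  have h3 : 1 ≤ (b - a) / w := (one_le_div hw).2 hwb
  have hN0 : (0 : ℝ) < N := by linarith
  by_contra! hcon
  have hsub : Icc a b ⊆ ⋃ k ∈ Finset.range N, Icc (a + k * w) (a + k * w + w) ∩ Icc a b := by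
    intro x hx
    have hxa : 0 ≤ (x - a) / w := div_nonneg (sub_nonneg.2 hx.1) hw.le
    by_cases hxb : ⌊(x - a) / w⌋₊ < N
    · refine mem_biUnion (x := ⌊(x - a) / w⌋₊) (by simpa using hxb) ⟨⟨?_, ?_⟩, hx⟩
      · have := Nat.floor_le hxa
        rw [le_div_iff₀ hw] at this
        linarith
      · have := Nat.lt_floor_add_one ((x - a) / w)
        rw [div_lt_iff₀ hw] at this
        linarith
    · have h4 : (N : ℝ) ≤ (x - a) / w := (Nat.le_floor_iff hxa).1 (not_lt.1 hxb)
      have h5 : (x - a) / w ≤ (b - a) / w := by gcongr; exact hx.2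
      have h6 : (b - a) / w = N := le_antisymm h1 (h4.trans h5)
      have h7 : (x - a) / w = N := le_antisymm (h5.trans h1) h4
      rw [div_eq_iff hw.ne'] at h7
      have hN1 : 1 ≤ N := by exact_mod_cast hN0
      refine mem_biUnion (x := N - 1) (by simp; omega) ⟨⟨?_, ?_⟩, hx⟩ <;>
      · rw [Nat.cast_sub hN1]
        push_cast
        linarith
  have h4 : μ.real (Icc a b) ≤ ∑ k ∈ Finset.range N, μ.real (Icc (a + k * w) (a + k * w + w)) :=
    (measureReal_mono hsub (measure_ne_top _ _)).trans ((measureReal_biUnion_finset_le _ _).trans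
      (Finset.sum_le_sum fun k _ => measureReal_mono inter_subset_left))
  have h5 : ∑ k ∈ Finset.range N, μ.real (Icc (a + k * w) (a + k * w + w)) <
      ∑ k ∈ Finset.range N, w / (2 * (b - a)) * μ.real (Icc a b) := by
    refine Finset.sum_lt_sum_of_nonempty (by simpa using (by exact_mod_cast hN0.ne' : N ≠ 0))
      fun k hk => hcon _ ⟨by nlinarith [(Nat.cast_nonneg k : (0:ℝ) ≤ k)], ?_⟩
    have h6 : ((k : ℝ) + 1) ≤ N := by exact_mod_cast Finset.mem_range.1 hk
    have h7 : (k : ℝ) ≤ (b - a) / w := by linarith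
    rw [le_div_iff₀ hw] at h7
    linarith
  rw [Finset.sum_const, Finset.card_range, nsmul_eq_mul] at h5
  have h6 : (N : ℝ) * (w / (2 * (b - a)) * μ.real (Icc a b)) ≤ μ.real (Icc a b) := by
    have h7 : (N : ℝ) * (w / (2 * (b - a))) ≤ 1 := by
      rw [← mul_div_assoc, div_le_one (by positivity)]
      calc (N : ℝ) * w ≤ (2 * ((b - a) / w)) * w := by gcongr; linarith
        _ = _ := by field_simp
    rw [← mul_assoc]
    exact mul_le_of_le_one_left measureReal_nonneg h7
  linarith

lemma exists_lt_measureReal_Icc_div {μ : Measure ℝ} [IsFiniteMeasure μ] {X : ℝ}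
    (h : Filter.limsup (fun δ : ℝ => μ (Icc (X - δ) (X + δ)) / ENNReal.ofReal (2 * δ))
      (nhdsWithin 0 (Ioi 0)) = ⊤) {R : ℝ} (hR : 0 ≤ R) {δ₀ : ℝ} (hδ₀ : 0 < δ₀) :
    ∃ δ, 0 < δ ∧ δ < δ₀ ∧ R * (2 * δ) < μ.real (Icc (X - δ) (X + δ)) := by
  have h1 : ∃ᶠ δ in nhdsWithin (0 : ℝ) (Ioi 0),
      ENNReal.ofReal R < μ (Icc (X - δ) (X + δ)) / ENNReal.ofReal (2 * δ) :=
    Filter.frequently_lt_of_lt_limsup (h := by rw [h]; exact ENNReal.ofReal_lt_top)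
  obtain ⟨δ, hδ, hδ'⟩ := (h1.and_eventually (Ioo_mem_nhdsGT hδ₀)).exists
  refine ⟨δ, hδ'.1, hδ'.2, ?_⟩
  have h2 : (0 : ℝ) < 2 * δ := by linarith [hδ'.1]
  rw [ENNReal.lt_div_iff_mul_lt (.inl (ENNReal.ofReal_pos.2 h2).ne') (.inl ENNReal.ofReal_ne_top), ← ENNReal.ofReal_mul hR,
    ENNReal.ofReal_lt_iff_lt_toReal (by positivity) (measure_ne_top _ _)] at hδ
  exact hδ

end pigeonhole

lemma badCount_mono (x : ℕ → ℝ) (M : ℕ) {m n : ℕ} (h : m ≤ n) : badCount x M m ≤ badCount x M n :=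
  Finset.card_le_card (Finset.filter_subset_filter _ (by simpa using h))

lemma exists_encard_zeros_eq {f : ℝ → ℝ} (hf : Continuous f)
    (hcross : ∀ z, f z = 0 → ∀ η > 0, (∃ t, |t - z| < η ∧ 0 < f t) ∧ ∃ t, |t - z| < η ∧ f t < 0)
    {σ : ℝ} (hσ : 0 < σ) (hne : ∀ j : ℕ, f (j * σ) ≠ 0) {n : ℕ} {r T : ℝ} (hr : 0 < r)
    (hfew : ∃ᶠ M : ℕ in Filter.atTop,
      (fun i : ℕ => f (i * (σ / M))) ∈ fewDefects M (n + 1) (ENNReal.ofReal r))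
    (hT : n * σ ≤ T) (hT' : T ≤ (n + 1) * σ) :
    ∃ N : ℕ, {t ∈ Icc 0 T | f t = 0}.encard = N ∧ (N : ℝ) ≤ n + 1 + 2 * r ∧ n - 2 * r ≤ N := by
  have hupper (Z : Finset ℝ) (hZ : (Z : Set ℝ) ⊆ {t ∈ Icc 0 T | f t = 0}) :
      (Z.card : ℝ) ≤ n + 1 + 2 * r := by
    obtain ⟨M, hM, hM'⟩ := (hfew.and_eventually (card_zeros_le_upCount hf hcross hσ hne (n + 1) Z
      fun z hz => ⟨(hZ hz).2, (hZ hz).1.1, (hZ hz).1.2.trans (by exact_mod_cast hT')⟩)).exists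
    have h1 := hM.1
    rw [← ENNReal.ofReal_natCast, ENNReal.ofReal_lt_ofReal_iff hr] at h1
    have h2 : (Z.card : ℝ) ≤ (n + 1 : ℕ) + 2 * (upCount (fun i => f (i * (σ / M))) M (n + 1) : ℕ) := by
      exact_mod_cast hM'
    push_cast at h2
    linarith
  have hfin : {t ∈ Icc 0 T | f t = 0}.Finite := by
    by_contra hinf
    obtain ⟨Z, hZ, hZc⟩ := Set.Infinite.exists_subset_card_eq hinf (⌈n + 1 + 2 * r⌉₊ + 1)
    have h1 := hupper Z hZ
    rw [hZc] at h1
    push_cast at h1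
    linarith [Nat.le_ceil ((n : ℝ) + 1 + 2 * r)]
  refine ⟨hfin.toFinset.card, hfin.encard_eq_coe_toFinset_card, hupper _ (by simp), ?_⟩
  obtain ⟨M, hM, hM0⟩ := (hfew.and_eventually (Filter.eventually_gt_atTop 0)).exists
  have h1 := hM.2
  rw [← ENNReal.ofReal_natCast, ENNReal.ofReal_lt_ofReal_iff hr] at h1
  have h2 := le_card_zeros_add_badCount hf hσ n hfin.toFinset
    (fun z hz h0 => by simpa using ⟨⟨hz.1, hz.2.trans hT⟩, h0⟩) hM0
  have h3 := badCount_mono (fun i : ℕ => f (i * (σ / M))) M n.le_succ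
  have h4 : (n : ℝ) ≤ hfin.toFinset.card + 2 * (badCount (fun i : ℕ => f (i * (σ / M))) M n : ℕ) := by
    exact_mod_cast h2
  have h5 : (badCount (fun i : ℕ => f (i * (σ / M))) M n : ℝ) ≤
      badCount (fun i : ℕ => f (i * (σ / M))) M (n + 1) := by exact_mod_cast h3
  linarith

lemma integrable_sq_of_integrable_sq_mul_log_sq {μ : Measure ℝ} [IsFiniteMeasure μ]
    (h : Integrable (fun l : ℝ => l ^ 2 * (Real.log |l|) ^ 2) μ) :
    Integrable (fun l : ℝ => l ^ 2) μ := by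
  refine ((integrable_const (Real.exp 1 ^ 2)).add h).mono' (by fun_prop) (ae_of_all _ fun l => ?_)
  rw [Real.norm_of_nonneg (sq_nonneg l), Pi.add_apply]
  rcases le_total |l| (Real.exp 1) with h1 | h1
  · have h2 := sq_le_sq' (by linarith [abs_nonneg l, Real.exp_pos 1]) h1
    rw [sq_abs] at h2
    nlinarith [mul_nonneg (sq_nonneg l) (sq_nonneg (Real.log |l|))]
  · have h2 : 1 ≤ Real.log |l| := by
      rw [Real.le_log_iff_exp_le ((Real.exp_pos 1).trans_le h1)]
      exact h1
    nlinarith [mul_nonneg (sq_nonneg l) (by nlinarith : 0 ≤ Real.log |l| ^ 2 - 1),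
      sq_nonneg (Real.exp 1)]

lemma IsSGP.exp_div_four_le_measure_zeroCount {Ω : Type*} [MeasurableSpace Ω] {P : Measure Ω}
    [IsProbabilityMeasure P] {μ : Measure ℝ} [IsProbabilityMeasure μ] {F : ℝ → Ω → ℝ}
    {Λ A K l₀ w : ℝ} (hF : IsSGP P μ F)
    (hΛ : ∀ s, 1 - Λ * s ^ 2 / 2 ≤ covKernel μ s) (hΛ0 : 0 ≤ Λ) (hl₀ : 0 < l₀) (hA : 1 < A)
    (hK : 0 < K) {n : ℕ} {r κ T : ℝ} (hr : 0 < r) (hκr : (n + 1) * κ ≤ r / 8)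
    (hκ : ((2 * K + 2) / A + Real.exp (-K ^ 2 / 2)) * ((Λ + 3) * (Real.pi / l₀)) < κ)
    (hAr : (n + 2) * (1 / (A - 1) ^ 2) ≤ r / 8)
    (hI : 0 < μ.real (Icc l₀ (l₀ + w)))
    (hw : A * (w * ((n + 1) * (Real.pi / l₀))) ≤ 1)
    (hw' : A * (w * (1 + l₀ * ((n + 1) * (Real.pi / l₀)))) ≤ 1)
    (hT : n * (Real.pi / l₀) ≤ T) (hT' : T ≤ (n + 1) * (Real.pi / l₀)) :
    ENNReal.ofReal (Real.exp (-(A ^ 2 / μ.real (Icc l₀ (l₀ + w))) / 2) / 4) ≤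
      P {ω | ∃ N : ℕ, zeroCount F T ω = N ∧ (N : ℝ) ≤ n + 1 + 2 * r ∧ n - 2 * r ≤ N} := by
  have hσ : 0 < Real.pi / l₀ := div_pos Real.pi_pos hl₀
  have hcos (t : ℝ) : Real.pi * t / (Real.pi / l₀) = l₀ * t := by field_simp
  have hA0 : 0 ≤ A := by linarith
  refine (hF.exp_div_four_le_measure_frequently (n := n + 1) hΛ hΛ0 hσ hA hK hr
    (by exact_mod_cast hκr) hκ (by push_cast; convert hAr using 2; ring) hI (fun t => rfl)
    (fun t ht => ?_) (fun s hs t ht => ?_)).trans (measure_mono_ae ?_)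
  · rw [hcos]
    exact (abs_mean_cos_sub_le hA0 hI subset_rfl ht).trans (by exact_mod_cast hw)
  · rw [hcos, hcos]
    refine (abs_mean_cos_sub_sub_le hA0 hI hl₀.le subset_rfl hs ht).trans ?_
    rw [← mul_assoc]
    exact mul_le_of_le_one_left (abs_nonneg _) (by exact_mod_cast hw')
  · have h0 : ∀ᵐ ω ∂P, ∀ j : ℕ, F (j * (Real.pi / l₀)) ω ≠ 0 :=
      ae_all_iff.2 fun j => by simpa [ae_iff] using hF.measure_eq_zero (j * (Real.pi / l₀))
    filter_upwards [hF.ae_crossing hΛ, h0] with ω h1 h2 h3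
    exact exists_encard_zeros_eq (hF.1 ω) h1 hσ h2 hr h3 hT hT'

lemma exists_amplitude_level (B : ℝ) {κ η : ℝ} (hκ : 0 < κ) (hη : 0 < η) :
    ∃ A K : ℝ, 1 < A ∧ 0 < K ∧ ((2 * K + 2) / A + Real.exp (-K ^ 2 / 2)) * B < κ ∧
      1 / (A - 1) ^ 2 ≤ η := by
  have h1 : Filter.Tendsto (fun K : ℝ => (0 + Real.exp (-K ^ 2 / 2)) * B) Filter.atTop
      (nhds ((0 + 0) * B)) := by
    refine ((tendsto_const_nhds.add (Real.tendsto_exp_atBot.comp ?_))).mul_const B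
    exact (Filter.tendsto_neg_atTop_atBot.comp
      (Filter.tendsto_pow_atTop two_ne_zero)).atBot_div_const two_pos
  rw [add_zero, zero_mul] at h1
  obtain ⟨K, hK, hK0⟩ := ((h1.eventually_lt_const hκ).and (Filter.eventually_gt_atTop 0)).exists
  have h2 : Filter.Tendsto (fun A : ℝ => ((2 * K + 2) / A + Real.exp (-K ^ 2 / 2)) * B)
      Filter.atTop (nhds ((0 + Real.exp (-K ^ 2 / 2)) * B)) :=
    ((tendsto_const_nhds.div_atTop Filter.tendsto_id).add_const _).mul_const B
  have h3 : Filter.Tendsto (fun A : ℝ => 1 / (A - 1) ^ 2) Filter.atTop (nhds 0) :=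
    tendsto_const_nhds.div_atTop ((Filter.tendsto_pow_atTop two_ne_zero).comp
      (Filter.tendsto_atTop_add_const_right _ (-1) Filter.tendsto_id))
  obtain ⟨A, hA, hA', hA1⟩ := ((h2.eventually_lt_const hK).and
    ((h3.eventually_lt_const hη).and (Filter.eventually_gt_atTop 1))).exists
  exact ⟨A, K, hA1, hK0, hA, hA'.le⟩

lemma div_mem_Icc_of_zero_count_bounds {X ε l₀ δ T : ℝ} {n N : ℕ} (hX : 0 < X) (hε : 0 < ε)
    (hεX : ε ≤ X) (hl : l₀ ∈ Icc (X - δ) (X + δ)) (hδ : δ ≤ ε / 4) (hT : 0 < T)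
    (hεT : Real.pi ≤ ε / 4 * T) (hn : n * Real.pi ≤ l₀ * T) (hn' : l₀ * T ≤ (n + 1) * Real.pi)
    (hN : (N : ℝ) ≤ n + 1 + 2 * (ε / (12 * X) * (n + 1)))
    (hN' : n - 2 * (ε / (12 * X) * (n + 1)) ≤ (N : ℝ)) :
    (X - 2 * ε) / Real.pi ≤ (N : ℝ) / T ∧ (N : ℝ) / T ≤ (X + 2 * ε) / Real.pi := by
  have hπ := Real.pi_pos
  have h1 : (n + 1) * Real.pi ≤ (X + ε / 2) * T := by
    have : l₀ * T ≤ (X + ε / 4) * T := by gcongr; linarith [hl.2]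
    linarith
  have h2 : (X - ε / 2) * T ≤ n * Real.pi := by
    have : (X - ε / 4) * T ≤ l₀ * T := by gcongr; linarith [hl.1]
    linarith
  have h3 : 2 * (ε / (12 * X) * (n + 1)) * Real.pi ≤ ε / 4 * T := by
    calc _ = ε / (6 * X) * ((n + 1) * Real.pi) := by field_simp; ring
      _ ≤ ε / (6 * X) * (3 / 2 * X * T) :=
        mul_le_mul_of_nonneg_left (h1.trans (by gcongr; linarith)) (by positivity)
      _ = _ := by field_simp; ring
  have h4 : 0 < ε * T := by positivity
  constructor
  · rw [div_le_div_iff₀ hπ hT]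
    have := mul_le_mul_of_nonneg_right hN' hπ.le
    linarith
  · rw [div_le_div_iff₀ hT hπ]
    have := mul_le_mul_of_nonneg_right hN hπ.le
    linarith

end

theorem prop_lb_moreover
    {Ω : Type*} [MeasurableSpace Ω] (P : Measure Ω) [IsProbabilityMeasure P]
    (μ : Measure ℝ) [IsProbabilityMeasure μ]
    (hsymm : μ.map (fun x => -x) = μ)
    (hmom : Integrable (fun l : ℝ => l ^ 2 * (Real.log (abs l)) ^ 2) μ)
    (X : ℝ) (hX : 0 < X) (ε : ℝ) (hε : 0 < ε)
    (hpos : 0 < μ (Set.Icc (X - ε) (X + ε)))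
    (hlimsup : Filter.limsup
        (fun δ : ℝ => μ (Set.Icc (X - δ) (X + δ)) / ENNReal.ofReal (2 * δ))
        (nhdsWithin 0 (Set.Ioi 0)) = ⊤)
    (F : ℝ → Ω → ℝ) (hF : IsSGP P μ F) :
    ∀ c > (0:ℝ), ∃ T₀ > (0:ℝ), ∀ T ≥ T₀,
      ENNReal.ofReal (Real.exp (-c * T)) ≤
        P {ω | ∃ n : ℕ, zeroCount F T ω = n ∧
          (X - 2 * ε) / Real.pi ≤ (n : ℝ) / T ∧ (n : ℝ) / T ≤ (X + 2 * ε) / Real.pi} := by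
  intro c hc
  have hπ := Real.pi_pos
  have hsq := integrable_sq_of_integrable_sq_mul_log_sq hmom
  have hΛ := one_sub_le_covKernel μ hsq
  set Λ := ∫ l, l ^ 2 ∂μ
  have hΛ0 : 0 ≤ Λ := integral_nonneg fun l => sq_nonneg l
  obtain ⟨e, he, heε, heX⟩ : ∃ e : ℝ, 0 < e ∧ e ≤ ε ∧ e ≤ X :=
    ⟨min ε X, lt_min hε hX, min_le_left _ _, min_le_right _ _⟩
  set ρ := e / (12 * X) with hρ
  have hρ0 : 0 < ρ := by positivity
  obtain ⟨A, K, hA, hK, hAK, hAρ⟩ := exists_amplitude_level ((Λ + 3) * (2 * Real.pi / X))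
    (by positivity : 0 < ρ / 8) (by positivity : 0 < ρ / 16)
  have hA0 : 0 < A := by linarith
  set θ := 1 / (A * (3 + 4 * X)) with hθ
  have hθ0 : 0 < θ := by positivity
  have hAθ : A * θ * (3 + 4 * X) = 1 := by rw [hθ]; field_simp
  obtain ⟨δ, hδ0, hδe, hδ⟩ := exists_lt_measureReal_Icc_div hlimsup
    (by positivity : 0 ≤ 2 * A ^ 2 / (c * θ)) (by positivity : 0 < e / 4)
  refine ⟨1 + 8 / c + 4 * Real.pi / e + 2 * Real.pi / X + θ / (2 * δ), by positivity,
    fun T hT => ?_⟩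
  have p1 : 0 < 8 / c := by positivity
  have p2 : 0 < 4 * Real.pi / e := by positivity
  have p3 : 0 < 2 * Real.pi / X := by positivity
  have p4 : 0 < θ / (2 * δ) := by positivity
  have hT1 : 1 ≤ T := by linarith
  have hT0 : 0 < T := by linarith
  have hTc : 8 / c ≤ T := by linarith
  have hTe : 4 * Real.pi / e ≤ T := by linarith
  have hTX : 2 * Real.pi / X ≤ T := by linarith
  have hTδ : θ / (2 * δ) ≤ T := by linarith
  rw [div_le_iff₀ hc] at hTc
  rw [div_le_iff₀ he] at hTe
  rw [div_le_iff₀ (by positivity)] at hTδ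
  obtain ⟨l₀, hl, hμ⟩ := exists_Icc_measure_ge (μ := μ) (a := X - δ) (b := X + δ) (w := θ / T)
    (by linarith) (by positivity) (by rw [div_le_iff₀ hT0]; linarith)
  have hI : θ / T * (A ^ 2 / (c * θ)) < μ.real (Icc l₀ (l₀ + θ / T)) := by
    refine lt_of_lt_of_le ?_ hμ
    calc _ = θ / T / (2 * (X + δ - (X - δ))) * (2 * A ^ 2 / (c * θ) * (2 * δ)) := by
          rw [show X + δ - (X - δ) = 2 * δ by ring]; field_simp
      _ < _ := mul_lt_mul_of_pos_left hδ (div_pos (by positivity) (by linarith))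
  have hI0 : 0 < μ.real (Icc l₀ (l₀ + θ / T)) := lt_trans (by positivity) hI
  have hlX : X / 2 ≤ l₀ := by linarith [hl.1]
  have hl2X : l₀ ≤ 2 * X := by linarith [hl.2]
  have hl0 : 0 < l₀ := by linarith
  have hσ0 : 0 < Real.pi / l₀ := by positivity
  have hσ : Real.pi / l₀ ≤ 2 * Real.pi / X := by
    rw [div_le_div_iff₀ hl0 hX]; nlinarith
  set n := ⌊T / (Real.pi / l₀)⌋₊
  have hn : n * (Real.pi / l₀) ≤ T := by
    rw [← le_div_iff₀ hσ0]; exact Nat.floor_le (by positivity)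
  have hn' : T ≤ (n + 1) * (Real.pi / l₀) := by
    rw [← div_le_iff₀ hσ0]; exact (Nat.lt_floor_add_one _).le
  have hτ : (n + 1) * (Real.pi / l₀) ≤ 2 * T := by linarith
  have key := hF.exp_div_four_le_measure_zeroCount (n := n) (r := ρ * (n + 1)) (κ := ρ / 8)
    (T := T) hΛ hΛ0 hl0 hA hK (by positivity) (by linarith) ?_ ?_ hI0 ?_ ?_ hn hn'
  · refine le_trans (ENNReal.ofReal_le_ofReal ?_) (key.trans (measure_mono ?_))
    · have h1 : A ^ 2 / μ.real (Icc l₀ (l₀ + θ / T)) ≤ c * T := by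
        rw [div_le_iff₀ hI0]
        calc A ^ 2 = c * T * (θ / T * (A ^ 2 / (c * θ))) := by field_simp
          _ ≤ _ := by gcongr
      have h2 : Real.exp (-(c * T) / 2) ≤
          Real.exp (-(A ^ 2 / μ.real (Icc l₀ (l₀ + θ / T))) / 2) :=
        Real.exp_le_exp.2 (by linarith)
      have h3 : Real.exp (-c * T) * Real.exp (c * T / 2) = Real.exp (-(c * T) / 2) := by
        rw [← Real.exp_add]; ring_nf
      have h4 := mul_le_mul_of_nonneg_left
        (by linarith [Real.add_one_le_exp (c * T / 2)] : 4 ≤ Real.exp (c * T / 2))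
        (Real.exp_pos (-c * T)).le
      linarith
    · rintro ω ⟨N, hN, hN1, hN2⟩
      rw [← mul_div_assoc, div_le_iff₀ hl0] at hn
      rw [← mul_div_assoc, le_div_iff₀ hl0] at hn'
      obtain ⟨h1, h2⟩ := div_mem_Icc_of_zero_count_bounds hX he heX hl hδe.le hT0 (by linarith)
        (by linarith) (by linarith) hN1 hN2
      exact ⟨N, hN, le_trans (by gcongr) h1, h2.trans (by gcongr)⟩
  · refine lt_of_le_of_lt ?_ hAK
    gcongr
  · calc ((n : ℝ) + 2) * (1 / (A - 1) ^ 2) ≤ (2 * (n + 1)) * (ρ / 16) := by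
          gcongr
          linarith [(Nat.cast_nonneg n : (0 : ℝ) ≤ n)]
      _ = _ := by ring
  · calc A * (θ / T * ((n + 1) * (Real.pi / l₀))) ≤ A * (θ / T * (2 * T)) := by gcongr
      _ = A * θ * 2 := by field_simp
      _ ≤ A * θ * (3 + 4 * X) := by gcongr; linarith
      _ = 1 := hAθ
  · calc A * (θ / T * (1 + l₀ * ((n + 1) * (Real.pi / l₀))))
        ≤ A * (θ / T * (T + 2 * X * (2 * T))) := by gcongr
      _ = A * θ * (1 + 4 * X) := by field_simp; ring
      _ ≤ A * θ * (3 + 4 * X) := by gcongr; linarith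
      _ = 1 := hAθ
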